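/- arXiv:2105.06248 — 3 statements merged into one kernel-verified Lean document; each statement's English description precedes it below -/
import Mathlib

section
/- Let S = {x₁,…,x₁₂} be twelve distinct points of P², and let 𝒳 be the ℂ-vector space of homogeneous polynomials of degree 6 in ℂ[X,Y,Z] vanishing at all points of S and whose three first-order partial derivatives vanish at each of x₁,…,x₆. Suppose there exist irreducible homogeneous cubic polynomials C₁ and C₂ such that: C₁ vanishes at x₁,…,x₉ and vanishes at none of x₁₀,x₁₁,x₁₂; and C₂ vanishes at x₁,…,x₆,x₁₀,x₁₁,x₁₂ and vanishes at none of x₇,x₈,x₉. Then 𝒳 contains two polynomials P and Q whose common zero set {x ∈ P² : P(x) = Q(x) = 0} is a finite set containing S. -/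
open MvPolynomial

/-- Evaluation of a polynomial at (a representative of) a point of `ℙ²`,
as a linear map. -/
noncomputable def evalLin (v : Fin 3 → ℂ) : MvPolynomial (Fin 3) ℂ →ₗ[ℂ] ℂ :=
  (aeval v).toLinearMap

/-- The space `𝒳` of homogeneous polynomials of degree 6 vanishing at the twelve
points `x 0, …, x 11` and whose three first partial derivatives vanish at
`x 0, …, x 5`. -/
noncomputable def mathcalX (x : Fin 12 → Projectivization ℂ (Fin 3 → ℂ)) :
    Submodule ℂ (MvPolynomial (Fin 3) ℂ) :=
  homogeneousSubmodule (Fin 3) ℂ 6 ⊓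
    (⨅ i : Fin 12, LinearMap.ker (evalLin (x i).rep)) ⊓
    ⨅ i : Fin 6, ⨅ j : Fin 3,
      LinearMap.ker ((evalLin (x (Fin.castLE (by norm_num) i)).rep).comp
        ((pderiv (R := ℂ) j).toLinearMap))

section
attribute [local instance] MvPolynomial.gradedAlgebra

lemma homog_quot {c m : ℕ} {F G : MvPolynomial (Fin 3) ℂ} (hF : F.IsHomogeneous c) (h0 : F ≠ 0)
    (h : (F * G).IsHomogeneous (c + m)) : G.IsHomogeneous m := by
  classical
  have h1 := DirectSum.coe_decompose_mul_add_of_left_mem (homogeneousSubmodule (Fin 3) ℂ) (i := c) (j := m)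
    (b := G) ((mem_homogeneousSubmodule _ _).2 hF)
  rw [DirectSum.decompose_of_mem_same _ ((mem_homogeneousSubmodule _ _).2 h)] at h1
  have h2 := mul_left_cancel₀ h0 h1
  rw [h2]
  exact (mem_homogeneousSubmodule _ _).1 (SetLike.coe_mem _)

end

instance finH (n : ℕ) : FiniteDimensional ℂ (homogeneousSubmodule (Fin 3) ℂ n) :=
  Module.Finite.iff_fg.2 (homogeneousSubmodule_fg _ _ n)

lemma finrank_H (n : ℕ) : 2 * Module.finrank ℂ (homogeneousSubmodule (Fin 3) ℂ n) = (n+1)*(n+2) := by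
  classical
  have e : homogeneousSubmodule (Fin 3) ℂ n ≃ₗ[ℂ] ({d : Fin 3 →₀ ℕ | d.degree = n} →₀ ℂ) := by
    rw [homogeneousSubmodule_eq_finsupp_supported]
    exact AddMonoidAlgebra.supportedEquivFinsupp _
  have hs : {d : Fin 3 →₀ ℕ | d.degree = n} = (Finset.finsuppAntidiag (Finset.univ : Finset (Fin 3)) n : Set _) := by
    ext d
    simp [Finset.mem_finsuppAntidiag, Finsupp.degree_eq_sum]
  rw [hs] at e
  rw [e.finrank_eq, Module.finrank_finsupp_self]
  simp [Finset.card_finsuppAntidiag_nat_eq_choose]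
  have : (n+2).choose n = (n+2).choose 2 := by
    rw [← Nat.choose_symm_add]
  rw [add_comm 2 n, this, Nat.choose_two_right, Nat.mul_div_cancel' (Nat.even_mul_pred_self _).two_dvd]
  simp; ring

lemma bezout_aux {ι : Type*} [Fintype ι] [DecidableEq ι] {c e m : ℕ} {F P : MvPolynomial (Fin 3) ℂ}
    (hF : F.IsHomogeneous c) (hFi : Irreducible F) (hP : P.IsHomogeneous e) (hd : ¬ F ∣ P)
    (Φ : MvPolynomial (Fin 3) ℂ →ₗ[ℂ] (ι → ℂ)) (h1 : ∀ G, Φ (F * G) = 0) (h2 : ∀ G, Φ (P * G) = 0)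
    (h3 : ∀ i, ∃ f : MvPolynomial (Fin 3) ℂ, f.IsHomogeneous (c + e + m) ∧ Φ f = Pi.single i 1) :
    Fintype.card ι ≤ c * e := by
  have hF0 : F ≠ 0 := hFi.ne_zero
  have hP0 : P ≠ 0 := by rintro rfl; exact hd (dvd_zero _)
  set H := homogeneousSubmodule (Fin 3) ℂ with hH
  let A := (H (e + m)).map (LinearMap.mulLeft ℂ F)
  let B := (H (c + m)).map (LinearMap.mulLeft ℂ P)
  let D := (H m).map (LinearMap.mulLeft ℂ (P * F))
  have rk : ∀ (G : MvPolynomial (Fin 3) ℂ) (n : ℕ), G ≠ 0 →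
      Module.finrank ℂ ((H n).map (LinearMap.mulLeft ℂ G)) = Module.finrank ℂ (H n) := by
    intro G n hG
    exact LinearEquiv.finrank_eq (Submodule.equivMapOfInjective _ (mul_right_injective₀ hG) _).symm
  have hA := rk F (e + m) hF0
  have hB := rk P (c + m) hP0
  have hD := rk (P * F) m (mul_ne_zero hP0 hF0)
  have hAB : A ⊓ B ≤ D := by
    rintro u ⟨⟨a, ha, rfl⟩, ⟨b, hb, hab⟩⟩
    simp only [LinearMap.mulLeft_apply] at hab ⊢
    have : F ∣ P * b := ⟨a, hab⟩
    obtain ⟨b', rfl⟩ := (hFi.prime.dvd_or_dvd this).resolve_left hd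
    refine ⟨b', ?_, by simp [← hab, mul_assoc]⟩
    exact homog_quot hF hF0 hb
  have hsum := Submodule.finrank_sup_add_finrank_inf_eq A B
  have hinf := Submodule.finrank_mono hAB
  let Ψ := Φ.domRestrict (H (c + e + m))
  have hsurj : LinearMap.range Ψ = ⊤ := by
    rw [eq_top_iff]
    intro v _
    rw [pi_eq_sum_univ' v]
    refine Submodule.sum_mem _ fun i _ => Submodule.smul_mem _ _ ?_
    obtain ⟨f, hf, hfi⟩ := h3 i
    refine ⟨⟨f, hf⟩, ?_⟩
    change Φ f = _
    rw [hfi]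
  have hrn := LinearMap.finrank_range_add_finrank_ker Ψ
  rw [hsurj, finrank_top, Module.finrank_fintype_fun_eq_card] at hrn
  have hle : A ⊔ B ≤ (LinearMap.ker Ψ).map (H (c + e + m)).subtype := by
    refine sup_le ?_ ?_
    · rintro _ ⟨a, ha, rfl⟩
      have : F * a ∈ H (c + e + m) := by rw [add_assoc]; exact IsHomogeneous.mul hF ha
      exact ⟨⟨F * a, this⟩, h1 a, rfl⟩
    · rintro _ ⟨a, ha, rfl⟩
      have : P * a ∈ H (c + e + m) := by rw [add_comm c, add_assoc]; exact IsHomogeneous.mul hP ha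
      exact ⟨⟨P * a, this⟩, h2 a, rfl⟩
  have hle2 := Submodule.finrank_mono hle
  rw [Submodule.finrank_map_subtype_eq] at hle2
  have r1 := finrank_H (c + e + m)
  have r2 := finrank_H (c + m)
  have r3 := finrank_H (e + m)
  have r4 := finrank_H m
  change 2 * Module.finrank ℂ (H _) = _ at r1 r2 r3 r4
  change Module.finrank ℂ A = _ at hA
  change Module.finrank ℂ B = _ at hB
  change Module.finrank ℂ D = _ at hD
  nlinarith

noncomputable def lin (w : Fin 3 → ℂ) : MvPolynomial (Fin 3) ℂ := ∑ i, C (w i) * X i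

lemma lin_homog (w : Fin 3 → ℂ) : (lin w).IsHomogeneous 1 :=
  IsHomogeneous.sum _ _ _ fun i _ => isHomogeneous_C_mul_X _ _

lemma eval_lin (w v : Fin 3 → ℂ) : eval v (lin w) = w ⬝ᵥ v := by
  simp [lin, dotProduct]

lemma pderiv_lin (w : Fin 3 → ℂ) (j : Fin 3) : pderiv j (lin w) = C (w j) := by
  simp [lin, Fin.sum_univ_three, pderiv_X, Pi.single_apply]
  fin_cases j <;> simp

abbrev PP := Projectivization ℂ (Fin 3 → ℂ)

lemma cross_ne {a b : PP} (h : a ≠ b) : crossProduct a.rep b.rep ≠ 0 := by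
  have h1 := (Projectivization.independent_pair_iff_ne a b).2 h
  rw [Projectivization.independent_iff] at h1
  rw [ne_eq, ← not_ne_iff, not_not]
  apply crossProduct_ne_zero_iff_linearIndependent.2
  have h2 : (Projectivization.rep ∘ ![a, b] : Fin 2 → Fin 3 → ℂ) = ![a.rep, b.rep] := by
    ext i; fin_cases i <;> rfl
  rw [h2] at h1; exact h1

/-- a functional vanishing at `a`, being `1` at `b` -/
lemma exists_sep {a b : PP} (h : a ≠ b) : ∃ w : Fin 3 → ℂ, w ⬝ᵥ a.rep = 0 ∧ w ⬝ᵥ b.rep = 1 := by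
  obtain ⟨k, hk⟩ := Function.ne_iff.1 (cross_ne h)
  have key : ∃ w : Fin 3 → ℂ, w ⬝ᵥ a.rep = 0 ∧ w ⬝ᵥ b.rep ≠ 0 := by
    refine ⟨crossProduct (Pi.single k 1) a.rep, ?_, ?_⟩
    · rw [dotProduct_comm]; exact dot_cross_self _ _
    · rw [dotProduct_comm, triple_product_permutation]
      simpa using hk
  obtain ⟨w, h1, h2⟩ := key
  exact ⟨(w ⬝ᵥ b.rep)⁻¹ • w, by simp [h1], by simp [h2]⟩

lemma bezout {ι : Type*} [Fintype ι] {c e : ℕ} {F P : MvPolynomial (Fin 3) ℂ}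
    (hF : F.IsHomogeneous c) (hFi : Irreducible F) (hP : P.IsHomogeneous e) (hd : ¬ F ∣ P)
    (y : ι → PP) (hy : Function.Injective y) (h1 : ∀ i, eval (y i).rep F = 0)
    (h2 : ∀ i, eval (y i).rep P = 0) : Fintype.card ι ≤ c * e := by
  classical
  refine bezout_aux (m := Fintype.card ι) hF hFi hP hd
    (LinearMap.pi fun i => (aeval (y i).rep : MvPolynomial (Fin 3) ℂ →ₐ[ℂ] ℂ).toLinearMap) ?_ ?_ ?_
  · intro G; ext i; simp [aeval_eq_eval, h1]
  · intro G; ext i; simp [aeval_eq_eval, h2]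
  · intro i
    have : ∀ j, ∃ w : Fin 3 → ℂ, w ⬝ᵥ (y i).rep = 1 ∧ (j ≠ i → w ⬝ᵥ (y j).rep = 0) := by
      intro j
      by_cases h : j = i
      · obtain ⟨k, hk⟩ := Function.ne_iff.1 (y i).rep_nonzero
        refine ⟨Pi.single k ((y i).rep k)⁻¹, ?_, fun h' => absurd h h'⟩
        simpa using inv_mul_cancel₀ hk
      · obtain ⟨w, ha, hb⟩ := exists_sep (fun h' => h (hy h') : y j ≠ y i)
        exact ⟨w, hb, fun _ => ha⟩
    choose w hw1 hw2 using this
    refine ⟨(lin (w i)) ^ (c + e) * ∏ j, lin (w j), ?_, ?_⟩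
    · refine IsHomogeneous.mul ?_ ?_
      · simpa using (lin_homog (w i)).pow (c + e)
      · simpa using IsHomogeneous.prod Finset.univ (fun j => lin (w j)) (fun _ => 1) fun j _ => lin_homog _
    · ext k
      simp only [LinearMap.pi_apply, AlgHom.toLinearMap_apply, aeval_eq_eval]
      simp only [RingHom.coe_coe, coe_aeval_eq_eval, map_mul, map_pow, map_prod, eval_lin]
      by_cases hk : k = i
      · subst hk; simp [hw1]
      · rw [Pi.single_eq_of_ne hk, Finset.prod_eq_zero (Finset.mem_univ k) (hw2 k hk), mul_zero]

lemma zeros_finite {c e : ℕ} {F P : MvPolynomial (Fin 3) ℂ}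
    (hF : F.IsHomogeneous c) (hFi : Irreducible F) (hP : P.IsHomogeneous e) (hd : ¬ F ∣ P) :
    {y : PP | eval y.rep F = 0 ∧ eval y.rep P = 0}.Finite := by
  by_contra hinf
  obtain ⟨t, ht, hc⟩ := Set.Infinite.exists_subset_card_eq hinf (c * e + 1)
  have := bezout hF hFi hP hd (fun i : t => (i : PP)) Subtype.val_injective
    (fun i => (ht i.2).1) (fun i => (ht i.2).2)
  simp [hc] at this

lemma not_dvd_lin {F : MvPolynomial (Fin 3) ℂ} (hF : F.IsHomogeneous 3) {w : Fin 3 → ℂ}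
    (hw : w ≠ 0) : ¬ F ∣ lin w := by
  intro h
  have h0 : lin w ≠ 0 := by
    intro h'
    apply hw; ext j
    have := pderiv_lin w j
    rw [h', map_zero] at this
    simpa using this.symm
  have hF0 : F ≠ 0 := by rintro rfl; exact h0 (zero_dvd_iff.1 h)
  have := totalDegree_le_of_dvd_of_isDomain h h0
  rw [hF.totalDegree hF0, (lin_homog w).totalDegree h0] at this
  omega

/-- directional derivative at `a` in direction `b` -/
noncomputable def dd (a b : Fin 3 → ℂ) : MvPolynomial (Fin 3) ℂ →ₗ[ℂ] ℂ :=
  ∑ j, b j • (evalLin a).comp ((pderiv (R := ℂ) j).toLinearMap)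

lemma dd_apply (a b : Fin 3 → ℂ) (f) : dd a b f = ∑ j, b j * eval a (pderiv j f) := by
  simp [dd, evalLin, aeval_eq_eval]

lemma dd_mul (a b : Fin 3 → ℂ) (f g) :
    dd a b (f * g) = dd a b f * eval a g + eval a f * dd a b g := by
  simp only [dd_apply, Fin.sum_univ_three, pderiv_mul, map_add, map_mul]
  ring

lemma dd_lin (a b w : Fin 3 → ℂ) : dd a b (lin w) = w ⬝ᵥ b := by
  simp [dd_apply, pderiv_lin, dotProduct, mul_comm]

lemma sing_unique {F : MvPolynomial (Fin 3) ℂ} (hF : F.IsHomogeneous 3) (hFi : Irreducible F)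
    {a b : PP} (ha : eval a.rep F = 0) (hb : eval b.rep F = 0)
    (hda : ∀ j, eval a.rep (pderiv j F) = 0) (hdb : ∀ j, eval b.rep (pderiv j F) = 0) : a = b := by
  by_contra hab
  obtain ⟨u, hua, hub⟩ := exists_sep hab
  obtain ⟨v, hvb, hva⟩ := exists_sep (Ne.symm hab)
  set w := crossProduct a.rep b.rep with hw
  have hwa : w ⬝ᵥ a.rep = 0 := by rw [dotProduct_comm]; exact dot_self_cross _ _
  have hwb : w ⬝ᵥ b.rep = 0 := by rw [dotProduct_comm]; exact dot_cross_self _ _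
  have hdFa : dd a.rep b.rep F = 0 := by simp [dd_apply, hda]
  have hdFb : dd b.rep a.rep F = 0 := by simp [dd_apply, hdb]
  have hev : ∀ (p : Fin 3 → ℂ) f, evalLin p f = eval p f := by
    intro p f; simp [evalLin, aeval_eq_eval]
  have hl4 : ∀ s t : Fin 3 → ℂ, (lin s * lin s * lin s * lin t).IsHomogeneous (3 + 1 + 0) := fun s t =>
    (((lin_homog s).mul (lin_homog s)).mul (lin_homog s)).mul (lin_homog t)
  have := bezout_aux (m := 0) hF hFi (lin_homog w) (not_dvd_lin hF (cross_ne hab))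
    (LinearMap.pi ![evalLin a.rep, evalLin b.rep, dd a.rep b.rep, dd b.rep a.rep]) ?_ ?_ ?_
  · simp at this
  · intro G
    ext i
    fin_cases i <;> simp [hev, dd_mul, ha, hb, hdFa, hdFb]
  · intro G
    ext i
    fin_cases i <;> simp [hev, dd_mul, eval_lin, dd_lin, hwa, hwb]
  · intro i
    fin_cases i
    · refine ⟨_, hl4 v v, ?_⟩
      ext i
      fin_cases i <;> simp [hev, dd_mul, eval_lin, dd_lin, hua, hub, hva, hvb]
    · refine ⟨_, hl4 u u, ?_⟩
      ext i
      fin_cases i <;> simp [hev, dd_mul, eval_lin, dd_lin, hua, hub, hva, hvb]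
    · refine ⟨_, hl4 v u, ?_⟩
      ext i
      fin_cases i <;> simp [hev, dd_mul, eval_lin, dd_lin, hua, hub, hva, hvb]
    · refine ⟨_, hl4 u v, ?_⟩
      ext i
      fin_cases i <;> simp [hev, dd_mul, eval_lin, dd_lin, hua, hub, hva, hvb]

lemma pairing (r : Fin 6 → Fin 6 → Prop) (hs : ∀ i j, r i j → r j i)
    (h : ∀ i j k, i ≠ j → i ≠ k → j ≠ k → r i j → r i k → False) :
    ∃ σ : Equiv.Perm (Fin 6), ¬ r (σ 0) (σ 1) ∧ ¬ r (σ 2) (σ 3) ∧ ¬ r (σ 4) (σ 5) := by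
  have key : ∀ f : Fin 6 → Fin 6, Function.Injective f →
      (¬ ∃ σ : Equiv.Perm (Fin 6), ¬ r (σ 0) (σ 1) ∧ ¬ r (σ 2) (σ 3) ∧ ¬ r (σ 4) (σ 5)) →
      r (f 0) (f 1) ∨ r (f 2) (f 3) ∨ r (f 4) (f 5) := by
    intro f hf hn
    by_contra hc
    push Not at hc
    exact hn ⟨Equiv.ofBijective f (Finite.injective_iff_bijective.1 hf), by simpa using hc⟩
  by_contra hn
  have k1 := key ![0,1,2,3,4,5] (by decide) hn
  have k2 := key ![0,2,1,4,3,5] (by decide) hn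
  have k3 := key ![0,3,1,5,2,4] (by decide) hn
  have k4 := key ![0,4,1,3,2,5] (by decide) hn
  have k5 := key ![0,5,1,2,3,4] (by decide) hn
  simp at k1 k2 k3 k4 k5
  clear key hn
  have h' : ∀ i j k l, r i j → r k l → (i = k ∧ j ≠ l ∨ i = l ∧ j ≠ k ∨ j = k ∧ i ≠ l ∨ j = l ∧ i ≠ k) →
     i ≠ j → k ≠ l → False := by
    rintro i j k l h1 h2 (⟨rfl, h3⟩|⟨rfl, h3⟩|⟨rfl, h3⟩|⟨rfl, h3⟩) h4 h5
    · exact h _ _ _ h4 h5 h3 h1 h2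
    · exact h _ _ _ h4 h5.symm h3 h1 (hs _ _ h2)
    · exact h _ _ _ h4.symm h5 h3 (hs _ _ h1) h2
    · exact h _ _ _ h4.symm h5.symm h3 (hs _ _ h1) (hs _ _ h2)
  rcases k1 with k1|k1|k1 <;> rcases k2 with k2|k2|k2 <;>
  first
  | exact h' _ _ _ _ k1 k2 (by decide) (by decide) (by decide)
  | (rcases k3 with k3|k3|k3 <;>
     first
     | exact h' _ _ _ _ k1 k3 (by decide) (by decide) (by decide)
     | exact h' _ _ _ _ k2 k3 (by decide) (by decide) (by decide)
     | (rcases k4 with k4|k4|k4 <;>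
         first
         | exact h' _ _ _ _ k1 k4 (by decide) (by decide) (by decide)
         | exact h' _ _ _ _ k2 k4 (by decide) (by decide) (by decide)
         | exact h' _ _ _ _ k3 k4 (by decide) (by decide) (by decide)))

lemma sep7 {F : MvPolynomial (Fin 3) ℂ} (hF : F.IsHomogeneous 3) (hFi : Irreducible F)
    (p : PP) (q : Fin 6 → PP) (hp : eval p.rep F = 0) (hq : ∀ i, eval (q i).rep F = 0)
    (hinj : Function.Injective q) (hpq : ∀ i, q i ≠ p) :
    ∃ f : MvPolynomial (Fin 3) ℂ, f.IsHomogeneous 3 ∧ eval p.rep f ≠ 0 ∧ ∀ i, eval (q i).rep f = 0 := by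
  have hpair := pairing (fun i j => crossProduct (q i).rep (q j).rep ⬝ᵥ p.rep = 0) ?_ ?_
  · obtain ⟨σ, h1, h2, h3⟩ := hpair
    let L := fun i j => lin (crossProduct (q i).rep (q j).rep)
    have hL1 : ∀ i j, eval (q i).rep (L i j) = 0 := by
      intro i j; rw [eval_lin, dotProduct_comm]; exact dot_self_cross _ _
    have hL2 : ∀ i j, eval (q j).rep (L i j) = 0 := by
      intro i j; rw [eval_lin, dotProduct_comm]; exact dot_cross_self _ _
    refine ⟨L (σ 0) (σ 1) * L (σ 2) (σ 3) * L (σ 4) (σ 5),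
      ((lin_homog _).mul (lin_homog _)).mul (lin_homog _), ?_, ?_⟩
    · simp only [map_mul, L, eval_lin]
      exact mul_ne_zero (mul_ne_zero h1 h2) h3
    · intro i
      obtain ⟨k, rfl⟩ := σ.surjective i
      fin_cases k <;> simp [hL1, hL2]
  · intro i j h
    rw [← cross_anticomm, neg_dotProduct, h, neg_zero]
  · intro i j k hij hik hjk h1 h2
    have := bezout hF hFi (lin_homog (crossProduct (q i).rep p.rep))
      (not_dvd_lin hF (cross_ne (hpq i))) ![p, q i, q j, q k] ?_ ?_ ?_
    · simp at this
    · have e1 := hinj.ne hij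
      have e2 := hinj.ne hik
      have e3 := hinj.ne hjk
      have e4 := hpq i
      have e5 := hpq j
      have e6 := hpq k
      intro s t
      fin_cases s <;> fin_cases t <;> simp [e1, e2, e3, e4, e5, e6, e1.symm, e2.symm, e3.symm, e4.symm, e5.symm, e6.symm]
    · intro s; fin_cases s <;> simp [hp, hq]
    · have hh : ∀ a b c : Fin 3 → ℂ, crossProduct a b ⬝ᵥ c = 0 → crossProduct a c ⬝ᵥ b = 0 := by
        intro a b c h
        simp only [cross_apply, dotProduct, Fin.sum_univ_three, Matrix.cons_val] at h ⊢
        linear_combination -h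
      intro s; fin_cases s
      · simp [eval_lin, dotProduct_comm _ p.rep]
      · simp [eval_lin, dotProduct_comm _ (q i).rep]
      · simpa [eval_lin] using hh _ _ _ h1
      · simpa [eval_lin] using hh _ _ _ h2

lemma finrank_W {F : MvPolynomial (Fin 3) ℂ} (hF : F.IsHomogeneous 3) (hFi : Irreducible F)
    (y : Fin 7 → PP) (hy : Function.Injective y) (h : ∀ i, eval (y i).rep F = 0) :
    Module.finrank ℂ (homogeneousSubmodule (Fin 3) ℂ 3 ⊓ ⨅ i, LinearMap.ker (evalLin (y i).rep) :
      Submodule ℂ (MvPolynomial (Fin 3) ℂ)) ≤ 3 := by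
  set H := homogeneousSubmodule (Fin 3) ℂ 3
  have hev : ∀ (p : Fin 3 → ℂ) f, evalLin p f = eval p f := by
    intro p f; simp [evalLin, aeval_eq_eval]
  let Φ : MvPolynomial (Fin 3) ℂ →ₗ[ℂ] (Fin 7 → ℂ) := LinearMap.pi fun i => evalLin (y i).rep
  let Ψ := Φ.domRestrict H
  have hsurj : LinearMap.range Ψ = ⊤ := by
    rw [eq_top_iff]
    intro v _
    rw [pi_eq_sum_univ' v]
    refine Submodule.sum_mem _ fun i _ => Submodule.smul_mem _ _ ?_
    obtain ⟨f, hf, hfi, hfj⟩ := sep7 hF hFi (y i) (y ∘ i.succAbove) (h i) (fun j => h _)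
      (hy.comp Fin.succAbove_right_injective) (fun j => hy.ne (Fin.succAbove_ne i j))
    refine ⟨(eval (y i).rep f)⁻¹ • ⟨f, hf⟩, ?_⟩
    change Φ ((eval (y i).rep f)⁻¹ • f) = _
    ext k
    simp only [map_smul, Pi.smul_apply, Φ, LinearMap.pi_apply, hev]
    by_cases hk : k = i
    · subst hk; simp [hfi]
    · obtain ⟨j, rfl⟩ := Fin.exists_succAbove_eq hk
      have := hfj j
      simp only [Function.comp] at this
      simp [this]
  have hrn := LinearMap.finrank_range_add_finrank_ker Ψ
  rw [hsurj, finrank_top, Module.finrank_fintype_fun_eq_card] at hrn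
  have r := finrank_H 3
  change 2 * Module.finrank ℂ H = _ at r
  have hle : (H ⊓ ⨅ i, LinearMap.ker (evalLin (y i).rep)) ≤ (LinearMap.ker Ψ).map H.subtype := by
    rintro f ⟨hf, hf2⟩
    refine ⟨⟨f, hf⟩, ?_, rfl⟩
    simp only [SetLike.mem_coe, Submodule.mem_iInf, LinearMap.mem_ker] at hf2
    change Φ f = 0
    ext i; exact hf2 i
  have hle2 := Submodule.finrank_mono hle
  rw [Submodule.finrank_map_subtype_eq] at hle2
  simp at hrn r
  omega

lemma mem_X {x : Fin 12 → PP} {f} : f ∈ mathcalX x ↔ f.IsHomogeneous 6 ∧ (∀ i, eval (x i).rep f = 0) ∧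
    ∀ i : Fin 12, (i : ℕ) < 6 → ∀ j, eval (x i).rep (pderiv j f) = 0 := by
  simp only [mathcalX, evalLin, Submodule.mem_inf, mem_homogeneousSubmodule, Submodule.mem_iInf,
    LinearMap.mem_ker, LinearMap.comp_apply, AlgHom.toLinearMap_apply, aeval_eq_eval, and_assoc]
  refine and_congr Iff.rfl (and_congr Iff.rfl ⟨fun h i hi j => ?_, fun h i j => ?_⟩)
  · exact h ⟨i, hi⟩ j
  · exact h _ i.2 j

lemma finrank_X (x : Fin 12 → PP) : 4 ≤ Module.finrank ℂ (mathcalX x) := by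
  set H := homogeneousSubmodule (Fin 3) ℂ 6
  have hev : ∀ (p : Fin 3 → ℂ) f, evalLin p f = eval p f := by
    intro p f; simp [evalLin, aeval_eq_eval]
  let Φ : MvPolynomial (Fin 3) ℂ →ₗ[ℂ] (Fin 6 × Fin 3 ⊕ Fin 6 → ℂ) := LinearMap.pi
    (Sum.elim (fun k => (evalLin (x (Fin.castLE (by norm_num) k.1)).rep).comp
        ((pderiv (R := ℂ) k.2).toLinearMap)) (fun i => evalLin (x (Fin.natAdd 6 i)).rep))
  let Ψ := Φ.domRestrict H
  have hrn := LinearMap.finrank_range_add_finrank_ker Ψ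
  have hr := Submodule.finrank_le (LinearMap.range Ψ)
  rw [Module.finrank_fintype_fun_eq_card] at hr
  have r := finrank_H 6
  change 2 * Module.finrank ℂ H = _ at r
  have : FiniteDimensional ℂ (mathcalX x) := by
    have hX : mathcalX x ≤ H := fun f hf => (mem_X.1 hf).1
    exact Submodule.finiteDimensional_of_le hX
  have hle : (LinearMap.ker Ψ).map H.subtype ≤ mathcalX x := by
    rintro _ ⟨⟨f, hf⟩, hf2, rfl⟩
    have h0 : Φ f = 0 := hf2
    have hd : ∀ i : Fin 12, (i : ℕ) < 6 → ∀ j, eval (x i).rep (pderiv j f) = 0 := by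
      intro i hi j
      have := congrFun h0 (Sum.inl (⟨i, hi⟩, j))
      simpa [Φ, hev] using this
    refine mem_X.2 ⟨hf, ?_, hd⟩
    intro i
    by_cases hi : (i : ℕ) < 6
    · have := congrArg (eval (x i).rep) (IsHomogeneous.sum_X_mul_pderiv (φ := f) (n := 6) hf)
      simp [hd i hi] at this
      simpa using this
    · have := congrFun h0 (Sum.inr ⟨i - 6, by omega⟩)
      have e : Fin.natAdd 6 (⟨i - 6, by omega⟩ : Fin 6) = i := by ext; simp; omega
      simp only [Φ, LinearMap.pi_apply, Sum.elim_inr, hev] at this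
      rw [e] at this
      simpa using this
  have hle2 := Submodule.finrank_mono hle
  rw [Submodule.finrank_map_subtype_eq] at hle2
  simp at hr r
  omega

lemma exists_not_dvd (x : Fin 12 → PP) (hx : Function.Injective x) (A : Finset (Fin 12))
    (hA : A.card = 3) (hA6 : ∀ i ∈ A, 6 ≤ (i : ℕ)) {F G : MvPolynomial (Fin 3) ℂ}
    (hF : F.IsHomogeneous 3) (hFi : Irreducible F) (hG : G.IsHomogeneous 3) (hGi : Irreducible G)
    (hF6 : ∀ i : Fin 12, (i : ℕ) < 6 → eval (x i).rep F = 0) (hFA : ∀ i ∈ A, eval (x i).rep F ≠ 0)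
    (hG6 : ∀ i : Fin 12, (i : ℕ) < 6 → eval (x i).rep G = 0) (hGA : ∀ i ∈ A, eval (x i).rep G = 0) :
    ∃ P ∈ mathcalX x, ¬ F ∣ P := by
  classical
  by_contra hcon
  push Not at hcon
  obtain ⟨k, hk⟩ : ∃ k : Fin 12, ∀ i : Fin 12, (i : ℕ) < 6 → i ≠ k →
      ∃ j, eval (x i).rep (pderiv j F) ≠ 0 := by
    by_contra hn
    push Not at hn
    obtain ⟨i, hi, -, hdi⟩ := hn 11
    obtain ⟨i', hi', hne, hdi'⟩ := hn i
    exact hne (hx (sing_unique hF hFi (hF6 _ hi') (hF6 _ hi) hdi' hdi))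
  let T : Finset (Fin 12) := ((Finset.univ.filter fun i : Fin 12 => (i : ℕ) < 6).erase k) ∪ A
  have hT : 7 ≤ T.card := by
    rw [Finset.card_union_of_disjoint, hA]
    · have h1 := Finset.pred_card_le_card_erase (s := Finset.univ.filter fun i : Fin 12 => (i : ℕ) < 6) (a := k)
      have h2 : (Finset.univ.filter fun i : Fin 12 => (i : ℕ) < 6).card = 6 := by decide
      omega
    · rw [Finset.disjoint_left]
      intro i hi hiA
      have := hA6 i hiA
      simp at hi
      omega
  obtain ⟨T', hT', hc⟩ := Finset.exists_subset_card_eq hT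
  let y : Fin 7 → PP := fun i => x (T'.orderEmbOfFin hc i)
  have hyT : ∀ i, T'.orderEmbOfFin hc i ∈ T := fun i => hT' (Finset.orderEmbOfFin_mem _ _ _)
  have hW := finrank_W hG hGi y (hx.comp (T'.orderEmbOfFin hc).injective) (by
    intro i
    have := hyT i
    simp only [T, Finset.mem_union, Finset.mem_erase, Finset.mem_filter] at this
    rcases this with h | h
    · exact hG6 _ h.2.2
    · exact hGA _ h)
  set W := (homogeneousSubmodule (Fin 3) ℂ 3 ⊓ ⨅ i, LinearMap.ker (evalLin (y i).rep) :
      Submodule ℂ (MvPolynomial (Fin 3) ℂ))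
  have : FiniteDimensional ℂ W := Submodule.finiteDimensional_of_le inf_le_left
  have hle : mathcalX x ≤ W.map (LinearMap.mulLeft ℂ F) := by
    intro P hP
    obtain ⟨R, rfl⟩ := hcon P hP
    obtain ⟨h1, h2, h3⟩ := mem_X.1 hP
    refine ⟨R, ⟨homog_quot hF hFi.ne_zero h1, ?_⟩, rfl⟩
    simp only [SetLike.mem_coe, Submodule.mem_iInf, LinearMap.mem_ker]
    intro i
    have hev : ∀ (p : Fin 3 → ℂ) f, evalLin p f = eval p f := by
      intro p f; simp [evalLin, aeval_eq_eval]
    rw [hev]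
    have := hyT i
    simp only [T, Finset.mem_union, Finset.mem_erase, Finset.mem_filter] at this
    rcases this with h | h
    · obtain ⟨j, hj⟩ := hk _ h.2.2 h.1
      have h4 := h3 _ h.2.2 j
      rw [pderiv_mul, map_add, map_mul, map_mul, hF6 _ h.2.2, zero_mul, add_zero] at h4
      exact (mul_eq_zero.1 h4).resolve_left hj
    · have h4 := h2 (T'.orderEmbOfFin hc i)
      rw [map_mul] at h4
      exact (mul_eq_zero.1 h4).resolve_left (hFA _ h)
  have e1 := Submodule.finrank_mono hle
  have e2 := Submodule.finrank_map_le (LinearMap.mulLeft ℂ F) W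
  have e3 := finrank_X x
  omega

theorem exists_P_Q_discrete_common_zeros
    (x : Fin 12 → Projectivization ℂ (Fin 3 → ℂ)) (hx : Function.Injective x)
    (C₁ C₂ : MvPolynomial (Fin 3) ℂ)
    (hC₁h : C₁.IsHomogeneous 3) (hC₁irr : Irreducible C₁)
    (hC₂h : C₂.IsHomogeneous 3) (hC₂irr : Irreducible C₂)
    (hC₁v : ∀ i : Fin 12, (i : ℕ) < 9 → eval (x i).rep C₁ = 0)
    (hC₁n : ∀ i : Fin 12, 9 ≤ (i : ℕ) → eval (x i).rep C₁ ≠ 0)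
    (hC₂v : ∀ i : Fin 12, ((i : ℕ) < 6 ∨ 9 ≤ (i : ℕ)) → eval (x i).rep C₂ = 0)
    (hC₂n : ∀ i : Fin 12, (6 ≤ (i : ℕ) ∧ (i : ℕ) < 9) → eval (x i).rep C₂ ≠ 0) :
    ∃ P ∈ mathcalX x, ∃ Q ∈ mathcalX x,
      {y : Projectivization ℂ (Fin 3 → ℂ) |
        eval y.rep P = 0 ∧ eval y.rep Q = 0}.Finite ∧
      ∀ i : Fin 12, x i ∈
        {y : Projectivization ℂ (Fin 3 → ℂ) |
          eval y.rep P = 0 ∧ eval y.rep Q = 0} := by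
  obtain ⟨P1, hP1, hd1⟩ := exists_not_dvd x hx {9, 10, 11} (by decide) (by decide) hC₁h hC₁irr hC₂h hC₂irr
    (fun i hi => hC₁v i (by omega)) (fun i hi => hC₁n i (by revert i; decide))
    (fun i hi => hC₂v i (Or.inl hi)) (fun i hi => hC₂v i (Or.inr (by revert i; decide)))
  obtain ⟨P2, hP2, hd2⟩ := exists_not_dvd x hx {6, 7, 8} (by decide) (by decide) hC₂h hC₂irr hC₁h hC₁irr
    (fun i hi => hC₂v i (Or.inl hi)) (fun i hi => hC₂n i (by revert i; decide))
    (fun i hi => hC₁v i (by omega)) (fun i hi => hC₁v i (by revert i; decide))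
  obtain ⟨P, hP, h1, h2⟩ : ∃ P ∈ mathcalX x, ¬ C₁ ∣ P ∧ ¬ C₂ ∣ P := by
    by_cases h12 : C₂ ∣ P1
    · by_cases h21 : C₁ ∣ P2
      · exact ⟨P1 + P2, add_mem hP1 hP2, fun h => hd1 ((dvd_add_left h21).1 h),
          fun h => hd2 ((dvd_add_right h12).1 h)⟩
      · exact ⟨P2, hP2, h21, hd2⟩
    · exact ⟨P1, hP1, hd1, h12⟩
  have hQ : C₁ * C₂ ∈ mathcalX x := by
    refine mem_X.2 ⟨hC₁h.mul hC₂h, fun i => ?_, fun i hi j => ?_⟩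
    · rw [map_mul]
      by_cases hi : (i : ℕ) < 9
      · rw [hC₁v i hi, zero_mul]
      · rw [hC₂v i (Or.inr (by omega)), mul_zero]
    · rw [pderiv_mul, map_add, map_mul, map_mul, hC₁v i (by omega), hC₂v i (Or.inl hi)]
      simp
  have hP' := mem_X.1 hP
  refine ⟨P, hP, C₁ * C₂, hQ, ?_, fun i => ⟨hP'.2.1 i, (mem_X.1 hQ).2.1 i⟩⟩
  refine ((zeros_finite hC₁h hC₁irr hP'.1 h1).union (zeros_finite hC₂h hC₂irr hP'.1 h2)).subset ?_
  rintro y ⟨hy1, hy2⟩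
  rw [map_mul] at hy2
  rcases mul_eq_zero.1 hy2 with h | h
  · exact Or.inl ⟨h, hy1⟩
  · exact Or.inr ⟨h, hy1⟩
end

section
/- Let S be a set of 12 distinct points of P² such that no (possibly reducible) cubic curve contains 10 or more points of S. Then there exist an integer d with 3 ≤ d ≤ 6 and nonzero homogeneous polynomials P, Q ∈ ℂ[X,Y,Z] of degree d, having no common nonconstant factor in ℂ[X,Y,Z], such that Σ_{x ∈ S} min(ord_x(P), ord_x(Q)) ≥ 3d, where ord_x denotes the vanishing order at x. -/
open MvPolynomial

/-- The iterated partial derivative of `F` corresponding to the multi-index `m`. -/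
noncomputable def pderivMulti (m : Fin 3 → ℕ) (F : MvPolynomial (Fin 3) ℂ) :
    MvPolynomial (Fin 3) ℂ :=
  (fun G => pderiv (0 : Fin 3) G)^[m 0]
    ((fun G => pderiv (1 : Fin 3) G)^[m 1]
      ((fun G => pderiv (2 : Fin 3) G)^[m 2] F))

/-- The vanishing order of `F` at a point `x` of the projective plane: the largest `k`
such that all partial derivatives of `F` of total order `< k` vanish at `x`. -/
noncomputable def ordAt (F : MvPolynomial (Fin 3) ℂ)
    (x : Projectivization ℂ (Fin 3 → ℂ)) : ℕ :=
  sSup {k : ℕ | ∀ m : Fin 3 → ℕ, m 0 + m 1 + m 2 < k →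
    eval x.rep (pderivMulti m F) = 0}

/-- Polynomials vanishing on a finite set of vectors. -/
noncomputable def vanishOn (T : Finset (Fin 3 → ℂ)) : Submodule ℂ (MvPolynomial (Fin 3) ℂ) :=
  LinearMap.ker (LinearMap.pi (fun v : T => (aeval (R := ℂ) (v : Fin 3 → ℂ)).toLinearMap))

lemma mem_vanishOn (T : Finset (Fin 3 → ℂ)) (F : MvPolynomial (Fin 3) ℂ) :
    F ∈ vanishOn T ↔ ∀ v ∈ T, eval v F = 0 := by
  simp only [vanishOn, LinearMap.mem_ker, funext_iff, LinearMap.pi_apply, Pi.zero_apply,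
    AlgHom.toLinearMap_apply, Subtype.forall]
  simp [MvPolynomial.aeval_eq_eval]

lemma finrank_le_vanishOn (V : Submodule ℂ (MvPolynomial (Fin 3) ℂ)) [FiniteDimensional ℂ V]
    (T : Finset (Fin 3 → ℂ)) :
    Module.finrank ℂ V ≤ T.card + Module.finrank ℂ ↥(V ⊓ vanishOn T) := by
  set L := LinearMap.pi (fun v : T => (aeval (R := ℂ) (v : Fin 3 → ℂ)).toLinearMap)
    with hL
  have h1 := (L.domRestrict V).finrank_range_add_finrank_ker
  have h2 : Module.finrank ℂ (LinearMap.range (L.domRestrict V)) ≤ T.card := by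
    refine (Submodule.finrank_le _).trans ?_
    simp
  have h3 : (LinearMap.ker (L.domRestrict V)).map V.subtype = V ⊓ vanishOn T := by
    ext x
    simp [vanishOn, ← hL, and_comm]
  rw [← h3]
  have h5 : Module.finrank ℂ ↥((LinearMap.ker (L.domRestrict V)).map V.subtype) =
     Module.finrank ℂ (LinearMap.ker (L.domRestrict V)) :=
    (Submodule.equivMapOfInjective V.subtype V.injective_subtype _).finrank_eq.symm
  omega

instance finite_homog (n : ℕ) : FiniteDimensional ℂ (homogeneousSubmodule (Fin 3) ℂ n) :=
  Module.Finite.iff_fg.mpr (homogeneousSubmodule_fg (σ := Fin 3) (R := ℂ) n)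

lemma le_finrank_homog (n : ℕ) :
    (3 + n - 1).choose n ≤ Module.finrank ℂ (homogeneousSubmodule (Fin 3) ℂ n) := by
  have hc := Finset.card_finsuppAntidiag_nat_eq_choose (s := (Finset.univ : Finset (Fin 3))) n
  rw [Finset.card_univ, Fintype.card_fin] at hc
  let b : (Finset.univ : Finset (Fin 3)).finsuppAntidiag n → homogeneousSubmodule (Fin 3) ℂ n :=
    fun d => ⟨monomial d.1 1, by
      have := d.2
      rw [Finset.mem_finsuppAntidiag] at this
      refine isHomogeneous_monomial _ ?_
      rw [Finsupp.degree_eq_sum]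
      exact this.1⟩
  have hb : LinearIndependent ℂ b := by
    apply LinearIndependent.of_comp (homogeneousSubmodule (Fin 3) ℂ n).subtype
    have := (basisMonomials (Fin 3) ℂ).linearIndependent.comp
      (fun d : (Finset.univ : Finset (Fin 3)).finsuppAntidiag n => d.1) Subtype.val_injective
    convert this using 1
    funext d
    simp [b]
  have := hb.fintype_card_le_finrank
  rw [Fintype.card_coe, hc] at this
  exact this

lemma exists_form (n : ℕ) (T : Finset (Fin 3 → ℂ)) (h : T.card < (3 + n - 1).choose n) :
    ∃ F : MvPolynomial (Fin 3) ℂ, F ≠ 0 ∧ F.IsHomogeneous n ∧ ∀ v ∈ T, eval v F = 0 := by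
  have h1 := finrank_le_vanishOn (homogeneousSubmodule (Fin 3) ℂ n) T
  have h2 := le_finrank_homog n
  have h3 : (homogeneousSubmodule (Fin 3) ℂ n ⊓ vanishOn T) ≠ ⊥ := by
    intro h0
    rw [h0, finrank_bot] at h1
    omega
  obtain ⟨F, hF, hF0⟩ := Submodule.exists_mem_ne_zero_of_ne_bot h3
  exact ⟨F, hF0, hF.1, (mem_vanishOn _ _).1 hF.2⟩

lemma order_le_totalDegree (f : MvPolynomial (Fin 3) ℂ) (hf : f ≠ 0) :
    (f : MvPowerSeries (Fin 3) ℂ).order ≤ (f.totalDegree : ℕ∞) := by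
  obtain ⟨d, hd⟩ := MvPolynomial.ne_zero_iff.1 hf
  have h1 := MvPowerSeries.order_le (f := (f : MvPowerSeries (Fin 3) ℂ)) (d := d)
    (by rwa [MvPolynomial.coeff_coe])
  refine h1.trans ?_
  have := MvPolynomial.le_totalDegree (p := f) (s := d) (by rwa [MvPolynomial.mem_support_iff])
  rw [Finsupp.degree_eq_sum]
  rw [Finsupp.sum_fintype _ _ (by simp)] at this
  exact_mod_cast this

lemma homog_of_mul (f g : MvPolynomial (Fin 3) ℂ) (n : ℕ) (h0 : f * g ≠ 0)
    (h : (f * g).IsHomogeneous n) :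
    f.IsHomogeneous f.totalDegree := by
  have hf : f ≠ 0 := left_ne_zero_of_mul h0
  have hg : g ≠ 0 := right_ne_zero_of_mul h0
  have h1 := totalDegree_mul_of_isDomain hf hg
  rw [h.totalDegree h0] at h1
  have h2 := order_le_totalDegree f hf
  have h3 := order_le_totalDegree g hg
  have h4 : (n : ℕ∞) ≤ ((f * g : MvPolynomial (Fin 3) ℂ) : MvPowerSeries (Fin 3) ℂ).order := by
    refine MvPowerSeries.nat_le_order ?_
    intro d hd
    rw [MvPolynomial.coeff_coe]
    exact h.coeff_eq_zero hd.ne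
  rw [MvPolynomial.coe_mul, MvPowerSeries.order_mul] at h4
  have h5 : (f.totalDegree : ℕ∞) ≤ (f : MvPowerSeries (Fin 3) ℂ).order := by
    lift (f : MvPowerSeries (Fin 3) ℂ).order to ℕ using (ne_top_of_le_ne_top (by simp) h2) with a
    lift (g : MvPowerSeries (Fin 3) ℂ).order to ℕ using (ne_top_of_le_ne_top (by simp) h3) with b
    norm_cast at *
    omega
  intro d hd
  have h6 := MvPowerSeries.order_le (f := (f : MvPowerSeries (Fin 3) ℂ)) (d := d)
    (by rwa [MvPolynomial.coeff_coe])
  have h7 : f.totalDegree ≤ d.degree := by exact_mod_cast h5.trans h6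
  have := MvPolynomial.le_totalDegree (p := f) (s := d) (by rwa [MvPolynomial.mem_support_iff])
  rw [Finsupp.sum_fintype _ _ (by simp)] at this
  rw [Finsupp.degree_eq_sum] at h7
  have h8 : Finsupp.weight (1 : Fin 3 → ℕ) d = d.degree := by
    rw [Finsupp.degree_eq_weight_one]
    rfl
  rw [h8, Finsupp.degree_eq_sum]
  omega

lemma coeff_iter_pderiv (i : Fin 3) (k : ℕ) : ∀ (F : MvPolynomial (Fin 3) ℂ) (m : Fin 3 →₀ ℕ),
    coeff (m + Finsupp.single i k) F ≠ 0 → coeff m ((fun G => pderiv i G)^[k] F) ≠ 0 := by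
  induction k with
  | zero => intro F m h; simpa using h
  | succ k ih =>
    intro F m h
    rw [Function.iterate_succ_apply]
    apply ih
    rw [coeff_pderiv]
    refine mul_ne_zero ?_ ?_
    · rw [add_assoc, ← Finsupp.single_add]; exact h
    · exact_mod_cast Nat.succ_ne_zero (m i + 0 + (Finsupp.single i k) i)

lemma homog_iter_pderiv (i : Fin 3) (k : ℕ) : ∀ (F : MvPolynomial (Fin 3) ℂ) (n : ℕ),
    F.IsHomogeneous n → ((fun G => pderiv i G)^[k] F).IsHomogeneous (n - k) := by
  induction k with
  | zero => intro F n h; simpa using h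
  | succ k ih =>
    intro F n h
    rw [Function.iterate_succ_apply]
    have := ih _ _ (h.pderiv (i := i))
    rwa [Nat.sub_sub, add_comm] at this

lemma one_le_ordAt (F : MvPolynomial (Fin 3) ℂ) (n : ℕ) (hF0 : F ≠ 0) (hF : F.IsHomogeneous n)
    (x : Projectivization ℂ (Fin 3 → ℂ)) (hx : eval x.rep F = 0) : 1 ≤ ordAt F x := by
  obtain ⟨d, hd⟩ := MvPolynomial.ne_zero_iff.1 hF0
  have hdeg : d 0 + d 1 + d 2 = n := by
    by_contra hne
    apply hd
    apply hF.coeff_eq_zero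
    rw [Finsupp.degree_eq_sum, Fin.sum_univ_three]
    exact hne
  have hne : eval x.rep (pderivMulti d F) ≠ 0 := by
    have hh : (pderivMulti d F).IsHomogeneous 0 := by
      have := homog_iter_pderiv 0 (d 0) _ _ (homog_iter_pderiv 1 (d 1) _ _
        (homog_iter_pderiv 2 (d 2) _ _ hF))
      have e : n - d 2 - d 1 - d 0 = 0 := by omega
      rwa [e] at this
    have hc : coeff 0 (pderivMulti d F) ≠ 0 := by
      unfold pderivMulti
      apply coeff_iter_pderiv
      apply coeff_iter_pderiv
      apply coeff_iter_pderiv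
      convert hd using 2
      ext i
      fin_cases i <;> simp
    have := (totalDegree_zero_iff_isHomogeneous _).2 hh
    rw [totalDegree_eq_zero_iff_eq_C] at this
    rw [this, eval_C]
    exact hc
  unfold ordAt
  apply le_csSup
  · refine ⟨n, ?_⟩
    intro k hk
    by_contra hlt
    push Not at hlt
    exact hne (hk d (by omega))
  · intro m hm
    have h0 : m 0 = 0 := by omega
    have h1 : m 1 = 0 := by omega
    have h2 : m 2 = 0 := by omega
    simp [pderivMulti, h0, h1, h2, hx]

lemma eval_linear (l : MvPolynomial (Fin 3) ℂ) (hl : l.IsHomogeneous 1) (x y z : Fin 3 → ℂ)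
    (a b c : ℂ) :
    eval (a • x + b • y + c • z) l = a * eval x l + b * eval y l + c * eval z l := by
  have h : l ∈ Submodule.span ℂ (Set.range (X : Fin 3 → MvPolynomial (Fin 3) ℂ)) := by
    rw [← homogeneousSubmodule_one_eq_span_X]
    exact hl
  clear hl
  induction h using Submodule.span_induction with
  | mem p hp =>
    obtain ⟨i, rfl⟩ := hp
    simp
  | zero => simp
  | add p q _ _ hp hq => rw [map_add, hp, hq]; simp only [map_add]; ring
  | smul r p _ hp => simp only [smul_eval, hp]; ring

lemma eval_quadratic (g : MvPolynomial (Fin 3) ℂ) (hg : g.IsHomogeneous 2) (x y z : Fin 3 → ℂ) :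
    ∃ p q r : ℂ, ∀ a b c : ℂ, eval (a • x + b • y + c • z) g =
      a ^ 2 * eval x g + b ^ 2 * eval y g + c ^ 2 * eval z g + a * b * p + a * c * q
        + b * c * r := by
  have h : g ∈ homogeneousSubmodule (Fin 3) ℂ 1 * homogeneousSubmodule (Fin 3) ℂ 1 := by
    rw [← pow_two, homogeneousSubmodule_one_pow]
    exact hg
  clear hg
  induction h using Submodule.mul_induction_on' with
  | mem_mul_mem l hl l' hl' =>
    refine ⟨eval x l * eval y l' + eval y l * eval x l', eval x l * eval z l' + eval z l * eval x l',
      eval y l * eval z l' + eval z l * eval y l', fun a b c => ?_⟩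
    rw [map_mul, eval_linear l hl, eval_linear l' hl']
    simp only [map_mul]
    ring
  | add u _ v _ hu hv =>
    obtain ⟨p, q, r, h⟩ := hu
    obtain ⟨p', q', r', h'⟩ := hv
    refine ⟨p + p', q + q', r + r', fun a b c => ?_⟩
    rw [map_add, h, h']
    simp only [map_add]
    ring

/-- If no nonzero linear form kills `x, y, z`, they span. -/
lemma exists_comb (x y z : Fin 3 → ℂ)
    (h : ∀ l : MvPolynomial (Fin 3) ℂ, l ≠ 0 → l.IsHomogeneous 1 → eval x l = 0 → eval y l = 0 →
      eval z l = 0 → False) (w : Fin 3 → ℂ) : ∃ a b c : ℂ, a • x + b • y + c • z = w := by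
  by_cases htop : Submodule.span ℂ {x, y, z} = ⊤
  · have hw : w ∈ Submodule.span ℂ {x, y, z} := by rw [htop]; trivial
    obtain ⟨a, b, c, e⟩ := Submodule.mem_span_triple.1 hw
    exact ⟨a, b, c, e⟩
  · exfalso
    obtain ⟨φ, hφ, hle⟩ := Submodule.exists_le_ker_of_lt_top _ (lt_top_iff_ne_top.2 htop)
    have hev : ∀ v, eval v (∑ i, C (φ (Pi.single i 1)) * X i) = φ v := by
      intro v
      conv_rhs => rw [pi_eq_sum_univ' v]
      simp [mul_comm]
    refine h (∑ i, C (φ (Pi.single i 1)) * X i) ?_ ?_ ?_ ?_ ?_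
    · intro h0
      apply hφ
      ext1 v
      have := hev
      simp only [h0, map_zero] at this
      ext
      simp [← this]
    · exact IsHomogeneous.sum _ _ _ (fun i _ => isHomogeneous_C_mul_X _ _)
    · rw [hev]; exact hle (Submodule.subset_span (by simp))
    · rw [hev]; exact hle (Submodule.subset_span (by simp))
    · rw [hev]; exact hle (Submodule.subset_span (by simp))

open Classical in
/-- The points of `A` where `F` vanishes. -/
noncomputable def zeros (A : Finset (Fin 3 → ℂ)) (F : MvPolynomial (Fin 3) ℂ) :
    Finset (Fin 3 → ℂ) := A.filter (fun v => eval v F = 0)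

lemma mem_zeros {A : Finset (Fin 3 → ℂ)} {F : MvPolynomial (Fin 3) ℂ} {v : Fin 3 → ℂ} :
    v ∈ zeros A F ↔ v ∈ A ∧ eval v F = 0 := by simp [zeros]

lemma zeros_subset (A : Finset (Fin 3 → ℂ)) (F : MvPolynomial (Fin 3) ℂ) :
    zeros A F ⊆ A := by
  intro v hv
  exact (mem_zeros.1 hv).1

open Classical in
lemma zeros_bound (A : Finset (Fin 3 → ℂ)) (hA : A.card = 12)
    (hc : ∀ F : MvPolynomial (Fin 3) ℂ, F ≠ 0 → F.IsHomogeneous 3 → (zeros A F).card ≤ 9)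
    (j k N : ℕ) (hjk : j + k = 3) (hN : N < (3 + k - 1).choose k)
    (F : MvPolynomial (Fin 3) ℂ) (hF0 : F ≠ 0) (hF : F.IsHomogeneous j) :
    (zeros A F).card + N ≤ 9 := by
  by_contra hlt
  have hs : (A \ zeros A F).card + (zeros A F).card = 12 := by
    rw [Finset.card_sdiff_add_card_eq_card (zeros_subset A F), hA]
  obtain ⟨U, hU, hUc⟩ := Finset.exists_subset_card_eq
    (Nat.min_le_right N (A \ zeros A F).card)
  obtain ⟨G, hG0, hG, hGv⟩ := exists_form k U (by omega)
  have h1 := hc (F * G) (mul_ne_zero hF0 hG0) (by have h := hF.mul hG; rwa [hjk] at h)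
  have h2 : zeros A F ∪ U ⊆ zeros A (F * G) := by
    intro v hv
    rw [mem_zeros, map_mul]
    rcases Finset.mem_union.1 hv with hv | hv
    · rw [mem_zeros] at hv
      simp [hv]
    · exact ⟨(Finset.mem_sdiff.1 (hU hv)).1, by simp [hGv v hv]⟩
  have h3 := Finset.card_le_card h2
  rw [Finset.card_union_of_disjoint] at h3
  · omega
  · exact (Finset.disjoint_sdiff (s := zeros A F) (t := A)).mono_right hU

set_option maxHeartbeats 1000000 in
open Classical in
lemma no_fixed (A : Finset (Fin 3 → ℂ)) (hA : A.card = 12)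
    (hc : ∀ F : MvPolynomial (Fin 3) ℂ, F ≠ 0 → F.IsHomogeneous 3 → (zeros A F).card ≤ 9)
    (f : MvPolynomial (Fin 3) ℂ) (hf : Irreducible f)
    (hdvd : ∀ F ∈ homogeneousSubmodule (Fin 3) ℂ 4 ⊓ vanishOn A, f ∣ F) : False := by
  set V := homogeneousSubmodule (Fin 3) ℂ 4 ⊓ vanishOn A with hV
  have hVr : 3 ≤ Module.finrank ℂ V := by
    have h1 := finrank_le_vanishOn (homogeneousSubmodule (Fin 3) ℂ 4) A
    have h2 := le_finrank_homog 4
    have h3 : (3 + 4 - 1).choose 4 = 15 := by decide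
    rw [← hV] at h1
    omega
  have : FiniteDimensional ℂ V :=
    Module.finite_of_finrank_pos (by omega)
  have hf0 := hf.ne_zero
  set μ := LinearMap.mulLeft ℂ f with hμ
  have hinj : Function.Injective μ := by
    intro a b hab
    exact mul_left_cancel₀ hf0 hab
  set W := V.comap μ with hW
  have hmap : W.map μ = V := by
    rw [hW, Submodule.map_comap_eq, inf_eq_right]
    intro F hF
    obtain ⟨g, hg⟩ := hdvd F hF
    exact ⟨g, hg.symm⟩
  have eW : W ≃ₗ[ℂ] V := (Submodule.equivMapOfInjective μ hinj W).trans (LinearEquiv.ofEq _ _ hmap)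
  have : FiniteDimensional ℂ W := eW.symm.finiteDimensional
  have hWr : 3 ≤ Module.finrank ℂ W := by rw [eW.finrank_eq]; exact hVr
  have hW2 : ∀ U : Finset (Fin 3 → ℂ), U.card ≤ 2 → ∃ g ∈ W, g ≠ 0 ∧ ∀ v ∈ U, eval v g = 0 := by
    intro U hU
    have h1 := finrank_le_vanishOn W U
    have h3 : (W ⊓ vanishOn U) ≠ ⊥ := by
      intro h0
      rw [h0, finrank_bot] at h1
      omega
    obtain ⟨F, hF, hF0⟩ := Submodule.exists_mem_ne_zero_of_ne_bot h3
    exact ⟨F, hF.1, hF0, (mem_vanishOn _ _).1 hF.2⟩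
  have hWv : ∀ g ∈ W, ∀ v ∈ A \ zeros A f, eval v g = 0 := by
    intro g hg v hv
    have h1 : f * g ∈ V := hg
    rw [Finset.mem_sdiff, mem_zeros] at hv
    have h2 := (mem_vanishOn _ _).1 h1.2 v hv.1
    rw [map_mul] at h2
    rcases mul_eq_zero.1 h2 with h3 | h3
    · exact absurd ⟨hv.1, h3⟩ hv.2
    · exact h3
  have hWh : ∀ g ∈ W, g ≠ 0 → f.IsHomogeneous f.totalDegree ∧ g.IsHomogeneous g.totalDegree ∧
      f.totalDegree + g.totalDegree = 4 := by
    intro g hg hg0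
    have h1 : (f * g).IsHomogeneous 4 := (show f * g ∈ V from hg).1
    have hne := mul_ne_zero hf0 hg0
    refine ⟨homog_of_mul f g 4 hne h1, homog_of_mul g f 4 (mul_comm f g ▸ hne)
      (mul_comm f g ▸ h1), ?_⟩
    rw [← totalDegree_mul_of_isDomain hf0 hg0, h1.totalDegree hne]
  have hs : (A \ zeros A f).card + (zeros A f).card = 12 := by
    rw [Finset.card_sdiff_add_card_eq_card (zeros_subset A f), hA]
  obtain ⟨U, hU, hUc⟩ := Finset.exists_subset_card_eq
    (Nat.min_le_right 2 (zeros A f).card)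
  obtain ⟨g, hgW, hg0, hgU⟩ := hW2 U (by omega)
  obtain ⟨hfh, hgh, hdeg⟩ := hWh g hgW hg0
  have hgz : (A \ zeros A f).card + U.card ≤ (zeros A g).card := by
    rw [← Finset.card_union_of_disjoint]
    · apply Finset.card_le_card
      intro v hv
      rw [mem_zeros]
      rcases Finset.mem_union.1 hv with hv | hv
      · exact ⟨(Finset.mem_sdiff.1 hv).1, hWv g hgW v hv⟩
      · exact ⟨zeros_subset _ _ (hU hv), hgU v hv⟩
    · exact (Finset.sdiff_disjoint (s := zeros A f) (t := A)).mono_right hU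
  have hb := zeros_bound A hA hc
  have hb0 := fun F h0 h => hb 0 3 9 rfl (by decide) F h0 h
  have hb1 := fun F h0 h => hb 1 2 5 rfl (by decide) F h0 h
  have hb2 := fun F h0 h => hb 2 1 2 rfl (by decide) F h0 h
  have hcases : f.totalDegree = 0 ∨ f.totalDegree = 1 ∨ f.totalDegree = 2 ∨ f.totalDegree = 3 ∨
    f.totalDegree = 4 := by omega
  rcases hcases with he | he | he | he | he
  · apply hf.not_isUnit
    rw [totalDegree_eq_zero_iff_eq_C] at he
    rw [he] at hf0 ⊢
    exact (isUnit_iff_ne_zero.2 (by intro h; apply hf0; rw [h, C_0])).map C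
  · have hd : g.totalDegree = 3 := by omega
    rw [hd] at hgh
    rw [he] at hfh
    have := hb1 f hf0 hfh
    have := hc g hg0 hgh
    omega
  · have hd : g.totalDegree = 2 := by omega
    rw [hd] at hgh
    rw [he] at hfh
    have h1 := hb2 f hf0 hfh
    have h2 := hb2 g hg0 hgh
    have h7 : (A \ zeros A f).card = 5 := by omega
    -- no three points off the conic are collinear
    have h3 : ∀ l : MvPolynomial (Fin 3) ℂ, l ≠ 0 → l.IsHomogeneous 1 →
        ∀ x ∈ A \ zeros A f, ∀ y ∈ A \ zeros A f, ∀ z ∈ A \ zeros A f, x ≠ y → x ≠ z → y ≠ z →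
        eval x l = 0 → eval y l = 0 → eval z l = 0 → False := by
      intro l hl0 hl x hx y hy z hz hxy hxz hyz ex ey ez
      have h4 := hc (f * l) (mul_ne_zero hf0 hl0) (hfh.mul hl)
      have h5 : zeros A f ∪ {x, y, z} ⊆ zeros A (f * l) := by
        intro v hv
        rw [mem_zeros, map_mul]
        rw [Finset.mem_sdiff] at hx hy hz
        rcases Finset.mem_union.1 hv with hv | hv
        · rw [mem_zeros] at hv
          simp [hv]
        · simp only [Finset.mem_insert, Finset.mem_singleton] at hv
          rcases hv with rfl | rfl | rfl <;> simp [*]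
      have h6 := Finset.card_le_card h5
      rw [Finset.card_union_of_disjoint, Finset.card_eq_three.2 ⟨x, y, z, hxy, hxz, hyz, rfl⟩] at h6
      · omega
      · apply (Finset.disjoint_sdiff (s := zeros A f) (t := A)).mono_right
        intro v hv
        simp only [Finset.mem_insert, Finset.mem_singleton] at hv
        rcases hv with rfl | rfl | rfl <;> assumption
    obtain ⟨U', hU', hUc'⟩ := Finset.exists_subset_card_eq
      (show 3 ≤ (A \ zeros A f).card by omega)
    obtain ⟨x, y, z, hxy, hxz, hyz, rfl⟩ := Finset.card_eq_three.1 hUc'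
    obtain ⟨t, ht, htU⟩ := Finset.exists_mem_notMem_of_card_lt_card
      (show ({x, y, z} : Finset (Fin 3 → ℂ)).card < (A \ zeros A f).card by omega)
    have hx : x ∈ A \ zeros A f := hU' (by simp)
    have hy : y ∈ A \ zeros A f := hU' (by simp)
    have hz : z ∈ A \ zeros A f := hU' (by simp)
    simp only [Finset.mem_insert, Finset.mem_singleton, not_or] at htU
    obtain ⟨htx, hty, htz⟩ := htU
    have hspan := exists_comb x y z (fun l hl0 hl ex ey ez =>
      h3 l hl0 hl x hx y hy z hz hxy hxz hyz ex ey ez)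
    obtain ⟨k, hkW, hk0, hkU⟩ := hW2 {x + y, x + z} Finset.card_le_two
    obtain ⟨-, hkh, hkd⟩ := hWh k hkW hk0
    have hkd' : k.totalDegree = 2 := by omega
    rw [hkd'] at hkh
    obtain ⟨p, q, r, hq⟩ := eval_quadratic k hkh x y z
    rw [hWv k hkW x hx, hWv k hkW y hy, hWv k hkW z hz] at hq
    have hp0 : p = 0 := by
      have h4 := hq 1 1 0
      have h5 := hkU (x + y) (by simp)
      simp [h5] at h4
      exact h4.symm
    have hq0 : q = 0 := by
      have h4 := hq 1 0 1
      have h5 := hkU (x + z) (by simp)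
      simp [h5] at h4
      exact h4.symm
    have hr0 : r = 0 := by
      obtain ⟨a, b, c, e⟩ := hspan t
      have h4 := hq a b c
      rw [e, hWv k hkW t ht, hp0, hq0] at h4
      by_contra hr
      have hbc : b = 0 ∨ c = 0 := by
        by_contra hcon
        rw [not_or] at hcon
        apply mul_ne_zero (mul_ne_zero hcon.1 hcon.2) hr
        linear_combination -h4
      rcases hbc with rfl | rfl
      · obtain ⟨l, hl0, hl, hlv⟩ := exists_form 1 {x, z}
          (lt_of_le_of_lt Finset.card_le_two (by decide))
        have ex := hlv x (by simp)
        have ez := hlv z (by simp)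
        refine h3 l hl0 hl x hx z hz t ht hxz (Ne.symm htx) (Ne.symm htz) ex ez ?_
        rw [← e, eval_linear l hl, ex, ez]
        simp
      · obtain ⟨l, hl0, hl, hlv⟩ := exists_form 1 {x, y}
          (lt_of_le_of_lt Finset.card_le_two (by decide))
        have ex := hlv x (by simp)
        have ey := hlv y (by simp)
        refine h3 l hl0 hl x hx y hy t ht hxy (Ne.symm htx) (Ne.symm hty) ex ey ?_
        rw [← e, eval_linear l hl, ex, ey]
        simp
    apply hk0
    apply MvPolynomial.funext
    intro w
    obtain ⟨a, b, c, e⟩ := hspan w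
    rw [← e, hq a b c, hp0, hq0, hr0]
    simp
  · have hd : g.totalDegree = 1 := by omega
    rw [hd] at hgh
    rw [he] at hfh
    have := hc f hf0 hfh
    have := hb1 g hg0 hgh
    omega
  · have hd : g.totalDegree = 0 := by omega
    rw [hd] at hgh
    have := hb0 g hg0 hgh
    omega

lemma exists_coprime_pair (V : Submodule ℂ (MvPolynomial (Fin 3) ℂ)) (P : MvPolynomial (Fin 3) ℂ)
    (hP0 : P ≠ 0)
    (h : ∀ f : MvPolynomial (Fin 3) ℂ, Irreducible f → (∀ F ∈ V, f ∣ F) → False)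
    (hP : P ∈ V) :
    ∃ Q ∈ V, Q ≠ 0 ∧ ∀ f : MvPolynomial (Fin 3) ℂ, Irreducible f → f ∣ P → ¬ f ∣ Q := by
  classical
  let M : MvPolynomial (Fin 3) ℂ → Submodule ℂ V := fun f =>
    ((Ideal.span {f}).restrictScalars ℂ).comap V.subtype
  have hM : ∀ f (v : V), v ∈ M f ↔ f ∣ v.1 := by
    intro f v
    simp [M, Ideal.mem_span_singleton]
  let s : Finset (Submodule ℂ V) :=
    insert ⊥ ((UniqueFactorizationMonoid.factors P).toFinset.image M)
  have hs : ⊤ ∉ s := by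
    intro hmem
    rcases Finset.mem_insert.1 hmem with hb | hb
    · have : (⟨P, hP⟩ : V) ∈ (⊥ : Submodule ℂ V) := by rw [← hb]; trivial
      rw [Submodule.mem_bot] at this
      exact hP0 (congrArg Subtype.val this)
    · obtain ⟨f, hf, hfM⟩ := Finset.mem_image.1 hb
      rw [Multiset.mem_toFinset] at hf
      refine h f (UniqueFactorizationMonoid.irreducible_of_factor f hf) ?_
      intro F hF
      exact (hM f ⟨F, hF⟩).1 (by rw [hfM]; trivial)
  have hne := Subspace.biUnion_ne_univ_of_top_notMem hs
  rw [Set.ne_univ_iff_exists_notMem] at hne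
  obtain ⟨Q, hQ⟩ := hne
  simp only [Set.mem_iUnion, not_exists] at hQ
  refine ⟨Q.1, Q.2, ?_, ?_⟩
  · intro h0
    refine hQ ⊥ (Finset.mem_insert_self _ _) ?_
    have : Q = 0 := Subtype.ext h0
    simp [this]
  · intro f hf hfP hfQ
    obtain ⟨f', hf', ha⟩ := UniqueFactorizationMonoid.exists_mem_factors_of_dvd hP0 hf hfP
    refine hQ (M f') (Finset.mem_insert_of_mem (Finset.mem_image_of_mem _
      (Multiset.mem_toFinset.2 hf'))) ?_
    exact (hM f' Q).2 (ha.symm.dvd.trans hfQ)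

theorem exists_polys_total_weight_ge_three_d
    (S : Finset (Projectivization ℂ (Fin 3 → ℂ))) (hS : S.card = 12)
    (hcubic : ∀ F : MvPolynomial (Fin 3) ℂ, F ≠ 0 → F.IsHomogeneous 3 →
      {x ∈ (S : Set (Projectivization ℂ (Fin 3 → ℂ))) | eval x.rep F = 0}.ncard ≤ 9) :
    ∃ d : ℕ, 3 ≤ d ∧ d ≤ 6 ∧
      ∃ P Q : MvPolynomial (Fin 3) ℂ, P ≠ 0 ∧ Q ≠ 0 ∧
        P.IsHomogeneous d ∧ Q.IsHomogeneous d ∧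
        (¬ ∃ h : MvPolynomial (Fin 3) ℂ, 0 < h.totalDegree ∧ h ∣ P ∧ h ∣ Q) ∧
        3 * d ≤ ∑ x ∈ S, min (ordAt P x) (ordAt Q x) := by
  classical
  have hinj : Function.Injective
      (Projectivization.rep : Projectivization ℂ (Fin 3 → ℂ) → (Fin 3 → ℂ)) := by
    intro x y hxy
    rw [← x.mk_rep, ← y.mk_rep]
    simp only [hxy]
  set A := S.image Projectivization.rep with hAdef
  have hA : A.card = 12 := by rw [hAdef, Finset.card_image_of_injective _ hinj, hS]
  have hc : ∀ F : MvPolynomial (Fin 3) ℂ, F ≠ 0 → F.IsHomogeneous 3 → (zeros A F).card ≤ 9 := by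
    intro F h0 h
    have h1 := hcubic F h0 h
    have h2 : zeros A F = (S.filter (fun x => eval x.rep F = 0)).image Projectivization.rep := by
      ext v
      simp only [mem_zeros, hAdef, Finset.mem_image, Finset.mem_filter]
      constructor
      · rintro ⟨⟨x, hx, rfl⟩, hv⟩
        exact ⟨x, ⟨hx, hv⟩, rfl⟩
      · rintro ⟨x, ⟨hx, hv⟩, rfl⟩
        exact ⟨⟨x, hx, rfl⟩, hv⟩
    rw [h2, Finset.card_image_of_injective _ hinj, ← Set.ncard_coe_finset, Finset.coe_filter]
    exact h1
  obtain ⟨P, hP0, hP, hPA⟩ := exists_form 4 A (by rw [hA]; decide)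
  obtain ⟨Q, hQ, hQ0, hQf⟩ := exists_coprime_pair (homogeneousSubmodule (Fin 3) ℂ 4 ⊓ vanishOn A)
    P hP0 (no_fixed A hA hc) ⟨hP, (mem_vanishOn _ _).2 hPA⟩
  have hQA := (mem_vanishOn _ _).1 hQ.2
  refine ⟨4, by norm_num, by norm_num, P, Q, hP0, hQ0, hP, hQ.1, ?_, ?_⟩
  · rintro ⟨h, hd, h1, h2⟩
    have hh0 : h ≠ 0 := by rintro rfl; simp at hd
    have hu : ¬ IsUnit h := by
      intro hu
      obtain ⟨g, hg⟩ := hu.exists_right_inv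
      have hg0 : g ≠ 0 := by rintro rfl; simp at hg
      have h3 := totalDegree_mul_of_isDomain hh0 hg0
      rw [hg, totalDegree_one] at h3
      omega
    obtain ⟨f, hf, hfh⟩ := WfDvdMonoid.exists_irreducible_factor hu hh0
    exact hQf f hf (hfh.trans h1) (hfh.trans h2)
  · calc 3 * 4 = ∑ x ∈ S, 1 := by simp [hS]
      _ ≤ _ := by
        apply Finset.sum_le_sum
        intro x hx
        have hxA : x.rep ∈ A := Finset.mem_image_of_mem _ hx
        exact le_min (one_le_ordAt P 4 hP0 hP x (hPA _ hxA))
          (one_le_ordAt Q 4 hQ0 hQ.1 x (hQA _ hxA))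
end

section
/- Let S = {x₁,…,x₁₂} be twelve distinct points of P² such that no (possibly reducible) cubic curve contains 10 or more points of S. Suppose C and C̃ are irreducible homogeneous polynomials of degree 2 such that C vanishes at x₁,…,x₇ and C̃ vanishes at x₈,…,x₁₂. Then there exist two ℂ-linearly independent homogeneous polynomials P₁, P₂ of degree 4, both vanishing at every point of S, having no common nonconstant factor in ℂ[X,Y,Z]; in particular, the common zero set {x ∈ P² : P₁(x) = P₂(x) = 0} is a finite set containing S. -/
open MvPolynomial

namespace TwoConics

abbrev Poly3 := MvPolynomial (Fin 3) ℂ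
abbrev Pt := Projectivization ℂ (Fin 3 → ℂ)

/-- the linear form vanishing on the span of `p` and `q`. -/
noncomputable def line (p q : Fin 3 → ℂ) : Poly3 :=
  ∑ k, C (crossProduct p q k) * X k

lemma eval_line (p q r : Fin 3 → ℂ) :
    eval r (line p q) = (crossProduct p q) 0 * r 0 + (crossProduct p q) 1 * r 1
      + (crossProduct p q) 2 * r 2 := by
  simp [line, Fin.sum_univ_three]

lemma eval_line_left (p q : Fin 3 → ℂ) : eval p (line p q) = 0 := by
  rw [eval_line]; simp [cross_apply]; ring

lemma eval_line_right (p q : Fin 3 → ℂ) : eval q (line p q) = 0 := by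
  rw [eval_line]; simp [cross_apply]; ring

lemma line_hom (p q : Fin 3 → ℂ) : (line p q).IsHomogeneous 1 :=
  IsHomogeneous.sum _ _ _ fun i _ => isHomogeneous_C_mul_X _ i

lemma cross_rep {a b : Pt} (h : a ≠ b) : crossProduct a.rep b.rep ≠ 0 := by
  rw [crossProduct_ne_zero_iff_linearIndependent]
  have := (Projectivization.independent_pair_iff_ne a b).2 h
  rw [Projectivization.independent_iff] at this
  have e : (Projectivization.rep ∘ ![a, b]) = ![a.rep, b.rep] := by
    ext i; fin_cases i <;> rfl
  rw [e] at this
  exact this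

lemma line_ne_zero {p q : Fin 3 → ℂ} (h : crossProduct p q ≠ 0) : line p q ≠ 0 := by
  intro h0
  apply h
  ext i
  have h1 := eval_line p q (Pi.single i 1)
  rw [h0, map_zero] at h1
  fin_cases i <;> simp at h1 ⊢ <;> exact h1.symm

lemma line_irred {p q : Fin 3 → ℂ} (h : crossProduct p q ≠ 0) : Irreducible (line p q) := by
  have h0 := line_ne_zero h
  apply irreducible_of_totalDegree_eq_one ((line_hom p q).totalDegree h0)
  intro x hx
  rw [isUnit_iff_ne_zero]
  rintro rfl
  apply h0
  ext d
  simpa using hx d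

lemma dvd_of_vanish {p q : Fin 3 → ℂ} (h : crossProduct p q ≠ 0) (F : Poly3)
    (hF : ∀ r, eval r (line p q) = 0 → eval r F = 0) : line p q ∣ F := by
  have hp : (Ideal.span {line p q}).IsPrime :=
    (Ideal.span_singleton_prime (line_ne_zero h)).2 (line_irred h).prime
  rw [← Ideal.mem_span_singleton,
    ← IsPrime.vanishingIdeal_zeroLocus (K := ℂ) (Ideal.span {line p q})]
  intro r hr
  have h1 := hr _ (Ideal.mem_span_singleton_self _)
  rw [aeval_eq_eval] at h1 ⊢
  exact hF r h1

lemma quad_form (F : Poly3) (hF : F.IsHomogeneous 2) :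
    ∃ a b c d e f : ℂ, ∀ v, eval v F = a * v 0 ^ 2 + b * v 1 ^ 2 + c * v 2 ^ 2
      + d * v 0 * v 1 + e * v 0 * v 2 + f * v 1 * v 2 := by
  have key : ∀ s : Finset (Fin 3 →₀ ℕ), (∀ m ∈ s, m.degree = 2) →
      ∃ a b c d e f : ℂ, ∀ v : Fin 3 → ℂ, eval v (∑ m ∈ s, monomial m (coeff m F))
        = a * v 0 ^ 2 + b * v 1 ^ 2 + c * v 2 ^ 2
        + d * v 0 * v 1 + e * v 0 * v 2 + f * v 1 * v 2 := by
    classical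
    intro s
    induction s using Finset.induction_on with
    | empty => intro _; exact ⟨0, 0, 0, 0, 0, 0, by simp⟩
    | insert m s hm ih =>
      intro hs
      obtain ⟨a, b, c, d, e, f, h⟩ := ih fun m hm => hs m (Finset.mem_insert_of_mem hm)
      have h2 := hs m (Finset.mem_insert_self _ _)
      rw [Finsupp.degree_eq_sum, Fin.sum_univ_three] at h2
      have hev : ∀ v : Fin 3 → ℂ, eval v (monomial m (coeff m F))
          = coeff m F * (v 0 ^ m 0 * v 1 ^ m 1 * v 2 ^ m 2) := by
        intro v
        rw [eval_monomial, Finsupp.prod_fintype _ _ (by simp), Fin.prod_univ_three]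
      have hc : (m 0 = 2 ∧ m 1 = 0 ∧ m 2 = 0) ∨ (m 0 = 0 ∧ m 1 = 2 ∧ m 2 = 0) ∨
        (m 0 = 0 ∧ m 1 = 0 ∧ m 2 = 2) ∨ (m 0 = 1 ∧ m 1 = 1 ∧ m 2 = 0) ∨
        (m 0 = 1 ∧ m 1 = 0 ∧ m 2 = 1) ∨ (m 0 = 0 ∧ m 1 = 1 ∧ m 2 = 1) := by omega
      simp only [Finset.sum_insert hm, map_add, h, hev]
      generalize coeff m F = k
      rcases hc with ⟨h0, h1, h2⟩ | ⟨h0, h1, h2⟩ | ⟨h0, h1, h2⟩ | ⟨h0, h1, h2⟩ |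
        ⟨h0, h1, h2⟩ | ⟨h0, h1, h2⟩ <;> simp only [h0, h1, h2]
      · exact ⟨a + k, b, c, d, e, f, fun v => by ring⟩
      · exact ⟨a, b + k, c, d, e, f, fun v => by ring⟩
      · exact ⟨a, b, c + k, d, e, f, fun v => by ring⟩
      · exact ⟨a, b, c, d + k, e, f, fun v => by ring⟩
      · exact ⟨a, b, c, d, e + k, f, fun v => by ring⟩
      · exact ⟨a, b, c, d, e, f + k, fun v => by ring⟩
  have := key F.support (fun m hm => (hF.degree_eq_sum_deg_support hm).symm)
  rwa [← F.as_sum] at this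

/-- A vector on the line through `p`, `q` is a combination of `p`, `q`. -/
lemma comb_of_line {p q r : Fin 3 → ℂ} (h : crossProduct p q ≠ 0)
    (hr : eval r (line p q) = 0) : ∃ s t : ℂ, r = s • p + t • q := by
  have h1 : crossProduct p q ≠ 0 := h
  rw [eval_line] at hr
  have : ∃ i, crossProduct p q i ≠ 0 := by
    by_contra! hc
    exact h (funext hc)
  obtain ⟨i, hi⟩ := this
  simp only [cross_apply] at hr hi
  fin_cases i <;> simp at hr hi
  · obtain ⟨u, hu⟩ : ∃ u, (p 1 * q 2 - p 2 * q 1) * u = 1 := ⟨_, mul_inv_cancel₀ hi⟩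
    refine ⟨(r 1 * q 2 - r 2 * q 1) * u, (p 1 * r 2 - p 2 * r 1) * u, ?_⟩
    ext j; fin_cases j <;> simp
    · linear_combination (-r 0) * hu + u * hr
    · linear_combination (-r 1) * hu
    · linear_combination (-r 2) * hu
  · obtain ⟨u, hu⟩ : ∃ u, (p 2 * q 0 - p 0 * q 2) * u = 1 := ⟨_, mul_inv_cancel₀ hi⟩
    refine ⟨(r 2 * q 0 - r 0 * q 2) * u, (p 2 * r 0 - p 0 * r 2) * u, ?_⟩
    ext j; fin_cases j <;> simp
    · linear_combination (-r 0) * hu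
    · linear_combination (-r 1) * hu + u * hr
    · linear_combination (-r 2) * hu
  · obtain ⟨u, hu⟩ : ∃ u, (p 0 * q 1 - p 1 * q 0) * u = 1 := ⟨_, mul_inv_cancel₀ hi⟩
    refine ⟨(r 0 * q 1 - r 1 * q 0) * u, (p 0 * r 1 - p 1 * r 0) * u, ?_⟩
    ext j; fin_cases j <;> simp
    · linear_combination (-r 0) * hu
    · linear_combination (-r 1) * hu
    · linear_combination (-r 2) * hu + u * hr

lemma not_collinear (F : Poly3) (hF : F.IsHomogeneous 2) (hirr : Irreducible F)
    {p q r : Pt} (hpq : p ≠ q) (hpr : p ≠ r) (hqr : q ≠ r)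
    (hp : eval p.rep F = 0) (hq : eval q.rep F = 0) (hr : eval r.rep F = 0) :
    eval r.rep (line p.rep q.rep) ≠ 0 := by
  intro hl
  have h := cross_rep hpq
  have h2 := cross_rep hpr
  have h3 := cross_rep hqr
  obtain ⟨s, t, hst⟩ := comb_of_line h hl
  have hs : s ≠ 0 := by
    rintro rfl
    apply h3; rw [hst]; simp
  have ht : t ≠ 0 := by
    rintro rfl
    apply h2; rw [hst]; simp
  obtain ⟨a, b, c, d, e, f, hQ⟩ := quad_form F hF
  have hdvd : line p.rep q.rep ∣ F := by
    apply dvd_of_vanish h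
    intro w hw
    obtain ⟨s', t', rfl⟩ := comb_of_line h hw
    rw [hst] at hr
    rw [hQ] at hr hp hq ⊢
    simp only [Pi.add_apply, Pi.smul_apply, smul_eq_mul] at hr ⊢
    have : s * t ≠ 0 := mul_ne_zero hs ht
    apply mul_left_cancel₀ this
    linear_combination (s' * t') * hr + (s * t * s' ^ 2 - s' * t' * s ^ 2) * hp
      + (s * t * t' ^ 2 - s' * t' * t ^ 2) * hq
  have hass := (line_irred h).associated_of_dvd hirr hdvd
  have h5 : F ∣ line p.rep q.rep := hass.symm.dvd
  have h6 := totalDegree_le_of_dvd_of_isDomain h5 (line_ne_zero h)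
  rw [hF.totalDegree hirr.ne_zero, (line_hom _ _).totalDegree (line_ne_zero h)] at h6
  omega

/-- products of lines separating points -/
lemma separate {ι : Type*} [DecidableEq ι] (F : Poly3) (hF : F.IsHomogeneous 2)
    (hirr : Irreducible F) (y : ι → Pt) (hy : Function.Injective y)
    (hyF : ∀ i, eval (y i).rep F = 0) (i : ι) (d : ℕ) :
    ∀ T : Finset ι, T.card = 2 * d → i ∉ T →
      ∃ G : Poly3, G.IsHomogeneous d ∧ (∀ j ∈ T, eval (y j).rep G = 0) ∧
        eval (y i).rep G ≠ 0 := by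
  induction d with
  | zero =>
    intro T hT hi
    have : T = ∅ := by simpa using hT
    subst this
    exact ⟨1, isHomogeneous_one _ _, by simp, by simp⟩
  | succ d ih =>
    intro T hT hi
    obtain ⟨a, b, ha, hb, hab⟩ := Finset.one_lt_card_iff.1 (by omega : 1 < T.card)
    obtain ⟨G, hG, hG0, hGi⟩ := ih ((T.erase a).erase b) (by
      rw [Finset.card_erase_of_mem (by simp [hb, hab.symm]), Finset.card_erase_of_mem ha]; omega)
      (by simp [hi])
    refine ⟨G * line (y a).rep (y b).rep, hG.mul (line_hom _ _), ?_, ?_⟩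
    · intro j hj
      by_cases h1 : j = a
      · subst h1; simp [eval_line_left]
      by_cases h2 : j = b
      · subst h2; simp [eval_line_right]
      rw [map_mul, hG0 j (by simp [h1, h2, hj]), zero_mul]
    · rw [map_mul]
      refine mul_ne_zero hGi (not_collinear F hF hirr (hy.ne hab) (hy.ne ?_) (hy.ne ?_)
        (hyF _) (hyF _) (hyF _))
      · rintro rfl; exact hi ha
      · rintro rfl; exact hi hb

lemma finrank_hom (n : ℕ) :
    Module.finrank ℂ (homogeneousSubmodule (Fin 3) ℂ n) = (n + 2).choose n := by
  classical
  have e : homogeneousSubmodule (Fin 3) ℂ n ≃ₗ[ℂ] ({d : Fin 3 →₀ ℕ | d.degree = n} →₀ ℂ) := by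
    rw [homogeneousSubmodule_eq_finsupp_supported]
    exact AddMonoidAlgebra.supportedEquivFinsupp _
  have hs : {d : Fin 3 →₀ ℕ | d.degree = n} = ↑(Finset.finsuppAntidiag (Finset.univ : Finset (Fin 3)) n) := by
    ext d
    simp [Finset.mem_finsuppAntidiag, Finsupp.degree_eq_sum]
  rw [hs] at e
  rw [e.finrank_eq, Module.finrank_finsupp_self, ← Nat.card_eq_fintype_card, Nat.card_coe_set_eq,
    Set.ncard_coe_finset, Finset.card_finsuppAntidiag_nat_eq_choose]
  simp [add_comm]

instance (n : ℕ) : FiniteDimensional ℂ (homogeneousSubmodule (Fin 3) ℂ n) :=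
  Module.Finite.iff_fg.2 (homogeneousSubmodule_fg (Fin 3) ℂ n)

/-- evaluation at a family of vectors -/
noncomputable def evalMap {ι : Type*} (n : ℕ) (v : ι → Fin 3 → ℂ) :
    homogeneousSubmodule (Fin 3) ℂ n →ₗ[ℂ] (ι → ℂ) :=
  (LinearMap.pi fun i => (aeval (v i) : Poly3 →ₐ[ℂ] ℂ).toLinearMap) ∘ₗ Submodule.subtype _

lemma evalMap_apply {ι : Type*} (n : ℕ) (v : ι → Fin 3 → ℂ) (G) (i : ι) :
    evalMap n v G i = eval (v i) (G : Poly3) := by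
  simp [evalMap]

lemma exists_quartic (v : Fin 13 → Fin 3 → ℂ) :
    ∃ G : Poly3, G ≠ 0 ∧ G.IsHomogeneous 4 ∧ ∀ i, eval (v i) G = 0 := by
  have h : LinearMap.ker (evalMap 4 v) ≠ ⊥ := by
    apply LinearMap.ker_ne_bot_of_finrank_lt
    rw [finrank_hom]; simp [Nat.choose]
  obtain ⟨G, hG, h0⟩ := Submodule.exists_mem_ne_zero_of_ne_bot h
  refine ⟨G, by simpa using h0, G.2, fun i => ?_⟩
  rw [← evalMap_apply, LinearMap.mem_ker.1 hG]; rfl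

/-- Bezout-type lemma: a form of degree `n+2` with `2(n+2)+1` zeros on an irreducible conic. -/
lemma conic_dvd (F : Poly3) (hF : F.IsHomogeneous 2) (hirr : Irreducible F) (n : ℕ)
    (y : Fin (2 * (n + 2) + 1) → Pt) (hy : Function.Injective y)
    (hyF : ∀ i, eval (y i).rep F = 0) (G : Poly3) (hG : G.IsHomogeneous (n + 2))
    (hyG : ∀ i, eval (y i).rep G = 0) :
    ∃ R : Poly3, R.IsHomogeneous n ∧ G = F * R := by
  set E := evalMap (n + 2) (fun i => (y i).rep) with hE
  have hsurj : LinearMap.range E = ⊤ := by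
    rw [eq_top_iff, ← (Pi.basisFun ℂ (Fin (2 * (n + 2) + 1))).span_eq, Submodule.span_le]
    rintro _ ⟨i, rfl⟩
    obtain ⟨H, hH, hH0, hHi⟩ := separate F hF hirr y hy hyF i (n + 2) (Finset.univ.erase i)
      (by simp) (by simp)
    refine ⟨(eval (y i).rep H)⁻¹ • ⟨H, hH⟩, ?_⟩
    ext j
    rw [map_smul, Pi.smul_apply, hE, evalMap_apply]
    by_cases hj : j = i
    · subst hj; simp [hHi]
    · simp [hH0 j (by simp [hj]), hj]
  have hrk := LinearMap.finrank_range_add_finrank_ker E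
  rw [hsurj, finrank_top, finrank_hom] at hrk
  simp only [Module.finrank_fintype_fun_eq_card, Fintype.card_fin] at hrk
  let M : homogeneousSubmodule (Fin 3) ℂ n →ₗ[ℂ] homogeneousSubmodule (Fin 3) ℂ (n + 2) :=
    LinearMap.codRestrict _ (LinearMap.mulLeft ℂ F ∘ₗ Submodule.subtype _) (fun R => by
      have := hF.mul R.2
      rw [add_comm] at this
      exact this)
  have hMinj : Function.Injective M := by
    intro a b hab
    have := congrArg Subtype.val hab
    exact Subtype.ext (mul_left_cancel₀ hirr.ne_zero this)
  have hle : LinearMap.range M ≤ LinearMap.ker E := by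
    rintro _ ⟨R, rfl⟩
    rw [LinearMap.mem_ker]
    ext i
    rw [evalMap_apply]
    change eval _ (F * (R : Poly3)) = 0
    rw [map_mul, hyF, zero_mul]
  have heq := Submodule.eq_of_le_of_finrank_le hle (by
    rw [LinearMap.finrank_range_of_inj hMinj, finrank_hom]
    have h1 : (n + 2 + 2).choose (n + 2) = (n + 4).choose 2 := Nat.choose_symm_add (a := n + 2) (b := 2)
    have h2 : (n + 2).choose n = (n + 2).choose 2 := Nat.choose_symm_add (a := n) (b := 2)
    have h3 : (n + 4).choose 2 = (n + 2).choose 2 + (2 * n + 5) := by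
      have e1 := Nat.choose_succ_succ (n + 3) 1
      have e2 := Nat.choose_succ_succ (n + 2) 1
      simp only [Nat.choose_one_right, Nat.succ_eq_add_one, Nat.reduceAdd, add_assoc] at e1 e2
      omega
    omega)
  have hmem : (⟨G, hG⟩ : homogeneousSubmodule (Fin 3) ℂ (n + 2)) ∈ LinearMap.range M := by
    rw [heq, LinearMap.mem_ker]
    ext i
    rw [evalMap_apply]
    exact hyG i
  obtain ⟨R, hR⟩ := hmem
  exact ⟨R, R.2, (congrArg Subtype.val hR).symm⟩

lemma hom_quot (F G : Poly3) (hF : F.IsHomogeneous 2) (hG : G.IsHomogeneous 4) (h : F ∣ G) :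
    ∃ R : Poly3, R.IsHomogeneous 2 ∧ G = F * R := by
  obtain ⟨R, rfl⟩ := h
  refine ⟨homogeneousComponent 2 R, homogeneousComponent_isHomogeneous _ _, ?_⟩
  have h1 : F * R = ∑ i ∈ Finset.range (R.totalDegree + 1), F * homogeneousComponent i R := by
    rw [← Finset.mul_sum, sum_homogeneousComponent]
  rw [← homogeneousComponent_eq_self hG]
  conv_lhs => rw [h1, map_sum]
  have h2 : ∀ i, homogeneousComponent 4 (F * homogeneousComponent i R)
      = if i = 2 then F * homogeneousComponent i R else 0 := by
    intro i
    rw [homogeneousComponent_of_mem (hF.mul (homogeneousComponent_isHomogeneous i R))]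
    congr 1
    simp only [eq_iff_iff]; omega
  simp only [h2, Finset.sum_ite_eq', Finset.mem_range]
  split_ifs with h3
  · rfl
  · rw [homogeneousComponent_eq_zero _ _ (by omega), mul_zero]

lemma card_le_seven (x : Fin 12 → Pt) (hx : Function.Injective x)
    (hcubic : ∀ F : Poly3, F ≠ 0 → F.IsHomogeneous 3 →
      {y ∈ Set.range x | eval y.rep F = 0}.ncard ≤ 9)
    (F : Poly3) (hF : F.IsHomogeneous 2) (hF0 : F ≠ 0) :
    (Finset.univ.filter fun i => eval (x i).rep F = 0).card ≤ 7 := by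
  classical
  set T := Finset.univ.filter fun i => eval (x i).rep F = 0 with hT
  by_contra! hlt
  have hij : ∃ i j, i ≠ j ∧ 10 ≤ (insert i (insert j T)).card := by
    by_cases h10 : 10 ≤ T.card
    · exact ⟨0, 1, by decide, h10.trans (Finset.card_le_card
        ((Finset.subset_insert _ _).trans (Finset.subset_insert _ _)))⟩
    · have hc : Tᶜ.card = 12 - T.card := by simp [Finset.card_compl]
      obtain ⟨i, j, hi, hj, hij⟩ := Finset.one_lt_card_iff.1 (by omega : 1 < Tᶜ.card)
      rw [Finset.mem_compl] at hi hj
      refine ⟨i, j, hij, ?_⟩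
      rw [Finset.card_insert_of_notMem (by simp [hi, hij]), Finset.card_insert_of_notMem hj]
      omega
  obtain ⟨i, j, hij, hU⟩ := hij
  have hl := line_ne_zero (cross_rep (hx.ne hij))
  have h9 := hcubic (F * line (x i).rep (x j).rep) (mul_ne_zero hF0 hl) (hF.mul (line_hom _ _))
  have hsub : ((insert i (insert j T)).image x : Set Pt) ⊆
      {y ∈ Set.range x | eval y.rep (F * line (x i).rep (x j).rep) = 0} := by
    intro y hy
    simp only [Finset.coe_image, Set.mem_image, Finset.mem_coe, Finset.mem_insert] at hy
    obtain ⟨k, hk, rfl⟩ := hy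
    refine ⟨⟨k, rfl⟩, ?_⟩
    rw [map_mul]
    rcases hk with rfl | rfl | hk
    · rw [eval_line_left, mul_zero]
    · rw [eval_line_right, mul_zero]
    · rw [hT, Finset.mem_filter] at hk
      rw [hk.2, zero_mul]
  have h10 := Set.ncard_le_ncard hsub ((Set.finite_range x).subset fun y hy => hy.1)
  rw [Set.ncard_coe_finset, Finset.card_image_of_injective _ hx] at h10
  omega

lemma multiple_of_dvd (x : Fin 12 → Pt) (hx : Function.Injective x)
    (F F' : Poly3) (hF : F.IsHomogeneous 2)
    (hF' : F'.IsHomogeneous 2) (hirr' : Irreducible F')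
    (hcard : (Finset.univ.filter fun i => eval (x i).rep F = 0).card ≤ 7)
    (hv : ∀ i, eval (x i).rep F = 0 ∨ eval (x i).rep F' = 0)
    (G : Poly3) (hG : G.IsHomogeneous 4) (hGv : ∀ i, eval (x i).rep G = 0) (hdvd : F ∣ G) :
    ∃ c : ℂ, G = C c * (F * F') := by
  classical
  obtain ⟨R, hR, rfl⟩ := hom_quot F G hF hG hdvd
  set T := Finset.univ.filter fun i => eval (x i).rep F = 0 with hT
  have hc : Tᶜ.card = 12 - T.card := by simp [Finset.card_compl]
  have h5 : 2 * (0 + 2) + 1 ≤ Tᶜ.card := by omega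
  let e := Finset.orderEmbOfCardLe Tᶜ h5
  have he : ∀ k, eval (x (e k)).rep F ≠ 0 := by
    intro k
    have := Finset.orderEmbOfCardLe_mem Tᶜ h5 k
    intro h0
    exact (Finset.mem_compl.1 this) (Finset.mem_filter.2 ⟨Finset.mem_univ _, h0⟩)
  obtain ⟨S, hS, rfl⟩ := conic_dvd F' hF' hirr' 0 (fun k => x (e k))
    (hx.comp e.injective) (fun k => (hv _).resolve_left (he k)) R hR (fun k => by
      have := hGv (e k)
      rw [map_mul] at this
      exact (mul_eq_zero.1 this).resolve_left (he k))
  have := (totalDegree_eq_zero_iff_eq_C).1 ((totalDegree_zero_iff_isHomogeneous _).2 hS)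
  refine ⟨coeff 0 S, ?_⟩
  rw [← this]; ring

lemma finite_inter (F : Poly3) (hF : F.IsHomogeneous 2) (hirr : Irreducible F)
    (G : Poly3) (hG : G.IsHomogeneous 4) (hdvd : ¬ F ∣ G) :
    {y : Pt | eval y.rep F = 0 ∧ eval y.rep G = 0}.Finite := by
  by_contra hinf
  have hinf : Set.Infinite _ := hinf
  let e := hinf.natEmbedding
  obtain ⟨R, -, hR⟩ := conic_dvd F hF hirr 2 (fun k => (e k : Pt))
    (fun a b hab => Fin.val_injective (e.injective (Subtype.ext hab)))
    (fun k => (e k).2.1) G hG (fun k => (e k).2.2)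
  exact hdvd ⟨R, hR⟩

end TwoConics

open TwoConics


theorem exists_quartics_for_two_irreducible_conics
    (x : Fin 12 → Projectivization ℂ (Fin 3 → ℂ)) (hx : Function.Injective x)
    (hcubic : ∀ F : MvPolynomial (Fin 3) ℂ, F ≠ 0 → F.IsHomogeneous 3 →
      {y ∈ Set.range x | eval y.rep F = 0}.ncard ≤ 9)
    (C Ct : MvPolynomial (Fin 3) ℂ)
    (hCh : C.IsHomogeneous 2) (hCirr : Irreducible C)
    (hCth : Ct.IsHomogeneous 2) (hCtirr : Irreducible Ct)
    (hCv : ∀ i : Fin 12, (i : ℕ) < 7 → eval (x i).rep C = 0)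
    (hCtv : ∀ i : Fin 12, 7 ≤ (i : ℕ) → eval (x i).rep Ct = 0) :
    ∃ P₁ P₂ : MvPolynomial (Fin 3) ℂ,
      P₁.IsHomogeneous 4 ∧ P₂.IsHomogeneous 4 ∧
      LinearIndependent ℂ ![P₁, P₂] ∧
      (∀ i : Fin 12, eval (x i).rep P₁ = 0 ∧ eval (x i).rep P₂ = 0) ∧
      (¬ ∃ h : MvPolynomial (Fin 3) ℂ, 0 < h.totalDegree ∧ h ∣ P₁ ∧ h ∣ P₂) ∧
      {y : Projectivization ℂ (Fin 3 → ℂ) |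
        eval y.rep P₁ = 0 ∧ eval y.rep P₂ = 0}.Finite := by
  
  have hcC := card_le_seven x hx hcubic C hCh hCirr.ne_zero
  have hcCt := card_le_seven x hx hcubic Ct hCth hCtirr.ne_zero
  have hv : ∀ i, eval (x i).rep C = 0 ∨ eval (x i).rep Ct = 0 := fun i =>
    (lt_or_ge (i : ℕ) 7).imp (hCv i) (hCtv i)
  have hne : C * Ct ≠ 0 := mul_ne_zero hCirr.ne_zero hCtirr.ne_zero
  obtain ⟨w, hw⟩ : ∃ w, eval w (C * Ct) ≠ 0 := by
    by_contra! h
    exact hne (MvPolynomial.funext fun w => by rw [h w, map_zero])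
  obtain ⟨G, hG0, hG, hGv⟩ := exists_quartic (Fin.cons w fun i => (x i).rep)
  have hGw : eval w G = 0 := hGv 0
  have hGx : ∀ i, eval (x i).rep G = 0 := fun i => hGv i.succ
  have hnot : ∀ c : ℂ, G ≠ MvPolynomial.C c * (C * Ct) := by
    rintro c rfl
    rw [map_mul, eval_C] at hGw
    rcases mul_eq_zero.1 hGw with h | h
    · apply hG0; rw [h, map_zero, zero_mul]
    · exact hw h
  have hd1 : ¬ C ∣ G := fun h => by
    obtain ⟨c, hc⟩ := multiple_of_dvd x hx C Ct hCh hCth hCtirr hcC hv G hG hGx h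
    exact hnot c hc
  have hd2 : ¬ Ct ∣ G := fun h => by
    obtain ⟨c, hc⟩ := multiple_of_dvd x hx Ct C hCth hCh hCirr hcCt (fun i => (hv i).symm) G hG hGx h
    exact hnot c (by rw [hc, mul_comm C])
  refine ⟨C * Ct, G, hCh.mul hCth, hG, ?_, fun i => ⟨?_, hGx i⟩, ?_, ?_⟩
  · rw [LinearIndependent.pair_iff' hne]
    intro a ha
    exact hnot a (by rw [← ha, MvPolynomial.smul_eq_C_mul])
  · rw [map_mul]; exact mul_eq_zero.2 (hv i)
  · rintro ⟨h, hpos, h1, h2⟩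
    have hnu : ¬ IsUnit h := fun hu => by
      rw [(MvPolynomial.isUnit_iff_totalDegree_of_isReduced.1 hu).2] at hpos
      exact lt_irrefl _ hpos
    have hh0 : h ≠ 0 := by rintro rfl; simp at hpos
    obtain ⟨g, hg, hgh⟩ := WfDvdMonoid.exists_irreducible_factor hnu hh0
    rcases hg.prime.dvd_or_dvd (hgh.trans h1) with h3 | h3
    · exact hd1 ((hg.associated_of_dvd hCirr h3).symm.dvd.trans (hgh.trans h2))
    · exact hd2 ((hg.associated_of_dvd hCtirr h3).symm.dvd.trans (hgh.trans h2))
  · apply ((finite_inter C hCh hCirr G hG hd1).union (finite_inter Ct hCth hCtirr G hG hd2)).subset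
    rintro y ⟨h1, h2⟩
    rw [map_mul] at h1
    exact (mul_eq_zero.1 h1).imp (fun h => ⟨h, h2⟩) (fun h => ⟨h, h2⟩)
end
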